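/- arXiv:0705.1850 — 12 statements merged into one kernel-verified Lean document; each statement's English description precedes it below -/
import Mathlib

section
/- Let G₀ and G₁ be divisible abelian groups. If there exist injective group homomorphisms f : G₀ → G₁ and g : G₁ → G₀, then G₀ and G₁ are isomorphic as groups. (This is the Schröder–Bernstein property for the category of divisible abelian groups with all injective group homomorphisms as arrows.) -/
/-- An abelian group `A` is divisible if every element is divisible by every
nonzero natural number. -/
def IsDivisibleGroup (A : Type*) [AddCommGroup A] : Prop :=
  ∀ (d : A) (n : ℕ), n ≠ 0 → ∃ y : A, n • y = d

theorem sbd_ext {Q M N : Type*} [AddCommGroup Q] [AddCommGroup M] [AddCommGroup N]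
    (hQ : IsDivisibleGroup Q) (i : M →+ N) (hi : Function.Injective i) (f : M →+ Q) :
    ∃ h : N →+ Q, ∀ x, h (i x) = f x := by
  have key : ∀ (a : Q) (n : ℤ), ∃ y : Q, n ≠ 0 → n • y = a := by
    intro a n
    by_cases hn : n = 0
    · exact ⟨0, fun h => absurd hn h⟩
    · obtain ⟨y, hy⟩ := hQ a n.natAbs (by simpa using hn)
      rcases Int.natAbs_eq n with h | h
      · refine ⟨y, fun _ => ?_⟩
        rw [h, natCast_zsmul, hy]
      · refine ⟨-y, fun _ => ?_⟩
        rw [h, neg_smul, smul_neg, neg_neg, natCast_zsmul, hy]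
  choose d hd using key
  letI : DivisibleBy Q ℤ :=
    { div := fun a n => if n = 0 then 0 else d a n
      div_zero := fun a => by simp
      div_cancel := fun {n} a hn => by simp only [hn, if_false]; exact hd a n hn }
  obtain ⟨h, hh⟩ := (Module.Baer.of_divisible Q).extension_property_addMonoidHom i hi f
  exact ⟨h, fun x => DFunLike.congr_fun hh x⟩

theorem sbd_retract {E D : Type*} [AddCommGroup E] [AddCommGroup D] (j : E →+ D) (p : D →+ E)
    (h : ∀ x, p (j x) = x) : Nonempty (D ≃+ p.ker × E) := by
  refine ⟨AddEquiv.symm (AddEquiv.ofBijective (p.ker.subtype.coprod j) ⟨?_, ?_⟩)⟩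
  · rw [injective_iff_map_eq_zero]
    rintro ⟨⟨c, hc⟩, e⟩ hce
    have hc' : p c = 0 := hc
    have h1 : c + j e = 0 := hce
    have h2 : e = 0 := by
      have := congrArg p h1
      simpa [hc', h] using this
    subst h2
    simpa using h1
  · intro x
    refine ⟨(⟨x - j (p x), by simp [AddMonoidHom.mem_ker, h]⟩, p x), ?_⟩
    simp

theorem sbd_ess_inj {X E Y : Type*} [AddCommGroup X] [AddCommGroup E] [AddCommGroup Y]
    (i : X →+ E) (he : ∀ e : E, e ≠ 0 → ∃ (n : ℤ) (x : X), n • e = i x ∧ x ≠ 0)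
    (t : E →+ Y) (ht : ∀ x, t (i x) = 0 → x = 0) : Function.Injective t := by
  rw [injective_iff_map_eq_zero]
  intro e h
  by_contra hne
  obtain ⟨n, x, h1, h2⟩ := he e hne
  apply h2
  apply ht
  rw [← h1, map_zsmul, h, smul_zero]

theorem sbd_unique {X E E' : Type*} [AddCommGroup X] [AddCommGroup E] [AddCommGroup E']
    (hE : IsDivisibleGroup E) (hE' : IsDivisibleGroup E')
    (i : X →+ E) (hi : Function.Injective i) (i' : X →+ E') (hi' : Function.Injective i')
    (he : ∀ e : E, e ≠ 0 → ∃ (n : ℤ) (x : X), n • e = i x ∧ x ≠ 0)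
    (he' : ∀ e : E', e ≠ 0 → ∃ (n : ℤ) (x : X), n • e = i' x ∧ x ≠ 0) :
    Nonempty (E ≃+ E') := by
  obtain ⟨t, ht⟩ := sbd_ext hE' i hi i'
  have tinj : Function.Injective t := sbd_ess_inj i he t (fun x hx => by
    rw [ht] at hx; exact (map_eq_zero_iff i' hi').1 hx)
  obtain ⟨r, hr⟩ := sbd_ext hE t tinj (AddMonoidHom.id E)
  have rinj : Function.Injective r := sbd_ess_inj i' he' r (fun x hx => by
    rw [← ht, hr] at hx; exact (map_eq_zero_iff i hi).1 hx)
  exact ⟨AddEquiv.ofBijective t ⟨tinj, fun y => ⟨r y, rinj (hr (r y))⟩⟩⟩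

theorem sbd_zorn {D : Type*} [AddCommGroup D] (S : AddSubgroup D) :
    ∃ K : AddSubgroup D, Maximal (fun K => Disjoint K S) K := by
  obtain ⟨K, -, hK⟩ := zorn_le_nonempty₀ {K : AddSubgroup D | Disjoint K S} (by
    intro c hc hchain y hy
    refine ⟨sSup c, ?_, fun z hz => le_sSup hz⟩
    show Disjoint (sSup c) S
    rw [AddSubgroup.disjoint_def]
    intro x hx hxS
    rw [AddSubgroup.mem_sSup_of_directedOn ⟨y, hy⟩ hchain.directedOn] at hx
    obtain ⟨s, hs, hxs⟩ := hx
    exact AddSubgroup.disjoint_def.1 (hc hs) hxs hxS) ⊥ disjoint_bot_left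
  exact ⟨K, hK⟩

theorem sbd_hull {X : Type*} {D : Type*} [AddCommGroup X] [AddCommGroup D]
    (hD : IsDivisibleGroup D) (u : X →+ D) (hu : Function.Injective u) :
    ∃ K : AddSubgroup D, IsDivisibleGroup (D ⧸ K) ∧
      ∃ (j : D ⧸ K →+ D) (p : D →+ D ⧸ K) (i : X →+ D ⧸ K),
      Function.Injective i ∧ (∀ e, p (j e) = e) ∧ (∀ x, j (i x) = u x) ∧
      ∀ e : D ⧸ K, e ≠ 0 → ∃ (n : ℤ) (x : X), n • e = i x ∧ x ≠ 0 := by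
  obtain ⟨K, hK⟩ := sbd_zorn u.range
  have hdis : ∀ {x : D}, x ∈ K → x ∈ u.range → x = 0 := AddSubgroup.disjoint_def.1 hK.prop
  have hdiv : IsDivisibleGroup (D ⧸ K) := by
    intro d n hn
    obtain ⟨d, rfl⟩ := QuotientAddGroup.mk'_surjective K d
    obtain ⟨y, rfl⟩ := hD d n hn
    exact ⟨QuotientAddGroup.mk' K y, by rw [map_nsmul]⟩
  let i : X →+ D ⧸ K := (QuotientAddGroup.mk' K).comp u
  have hi : Function.Injective i := by
    rw [injective_iff_map_eq_zero]
    intro x hx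
    have h1 : u x ∈ K := (QuotientAddGroup.eq_zero_iff _).1 hx
    exact (map_eq_zero_iff u hu).1 (hdis h1 ⟨x, rfl⟩)
  have hess : ∀ e : D ⧸ K, e ≠ 0 → ∃ (n : ℤ) (x : X), n • e = i x ∧ x ≠ 0 := by
    intro e he
    obtain ⟨d, rfl⟩ := QuotientAddGroup.mk'_surjective K e
    have hd : d ∉ K := fun h => he ((QuotientAddGroup.eq_zero_iff _).2 h)
    by_contra hcon
    push Not at hcon
    apply hd
    have hle : K ⊔ AddSubgroup.zmultiples d ≤ K := by
      refine hK.2 ?_ le_sup_left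
      show Disjoint _ _
      rw [AddSubgroup.disjoint_def]
      rintro y hy ⟨x, rfl⟩
      obtain ⟨k, hk, z, hz, hkz⟩ := AddSubgroup.mem_sup.1 hy
      obtain ⟨n, rfl⟩ := AddSubgroup.mem_zmultiples_iff.1 hz
      have : x = 0 := hcon n x (by
        have hk0 : QuotientAddGroup.mk' K k = 0 := (QuotientAddGroup.eq_zero_iff _).2 hk
        show _ = QuotientAddGroup.mk' K (u x)
        rw [← hkz, map_add, hk0, zero_add, map_zsmul])
      rw [this, map_zero]
    exact hle (AddSubgroup.mem_sup_right (AddSubgroup.mem_zmultiples d))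
  obtain ⟨j, hj⟩ := sbd_ext hD i hi u
  have jinj : Function.Injective j := sbd_ess_inj i hess j (fun x hx => by
    rw [hj] at hx; exact (map_eq_zero_iff u hu).1 hx)
  obtain ⟨p, hp⟩ := sbd_ext hdiv j jinj (AddMonoidHom.id _)
  exact ⟨K, hdiv, j, p, i, hi, hp, hj, hess⟩

/-- The Schröder–Bernstein property for divisible abelian groups with injective
group homomorphisms as arrows. -/
theorem sb_divisible {G₀ G₁ : Type*} [AddCommGroup G₀] [AddCommGroup G₁]
    (h₀ : IsDivisibleGroup G₀) (h₁ : IsDivisibleGroup G₁)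
    (f : G₀ →+ G₁) (hf : Function.Injective f)
    (g : G₁ →+ G₀) (hg : Function.Injective g) :
    Nonempty (G₀ ≃+ G₁) := by
  obtain ⟨p, hp⟩ := sbd_ext h₁ g hg (AddMonoidHom.id G₁)
  replace hp : ∀ y, p (g y) = y := hp
  obtain ⟨X, hX⟩ : ∃ X : AddSubgroup G₀, p.ker ⊔ X.map (g.comp f) = X :=
    let F : AddSubgroup G₀ →o AddSubgroup G₀ :=
      ⟨fun H => p.ker ⊔ H.map (g.comp f), fun _ _ h =>
        sup_le_sup_left (AddSubgroup.map_mono h) _⟩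
    ⟨F.lfp, F.map_lfp⟩
  have hX1 : ∀ c, p c = 0 → c ∈ X := fun c hc => by
    rw [← hX]; exact AddSubgroup.mem_sup_left hc
  have hX2 : ∀ x ∈ X, g (f x) ∈ X := fun x hx => by
    rw [← hX]; exact AddSubgroup.mem_sup_right ⟨x, hx, rfl⟩
  have hX3 : ∀ x ∈ X, ∃ x' ∈ X, p x = f x' := fun x hx => by
    rw [← hX] at hx
    obtain ⟨c, hc, z, ⟨x', hx', rfl⟩, rfl⟩ := AddSubgroup.mem_sup.1 hx
    have hc' : p c = 0 := hc
    exact ⟨x', hx', by simp [hc', hp]⟩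
  obtain ⟨K, hE, j, q, i, hi, hqj, hji, hess⟩ := sbd_hull h₁ (f.comp X.subtype)
    (hf.comp Subtype.val_injective)
  replace hji : ∀ x : X, j (i x) = f x := hji
  have hqf : ∀ x : X, q (f x) = i x := fun x => by rw [← hji, hqj]
  have hC : IsDivisibleGroup (p.ker × (G₁ ⧸ K)) := by
    rintro ⟨⟨c, hc⟩, e⟩ n hn
    have hc' : p c = 0 := hc
    obtain ⟨y, hy⟩ := h₀ c n hn
    obtain ⟨z, hz⟩ := hE e n hn
    refine ⟨(⟨y - g (p y), by simp [AddMonoidHom.mem_ker, hp]⟩, z), ?_⟩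
    ext
    · show n • (y - g (p y)) = c
      rw [smul_sub, ← map_nsmul, ← map_nsmul, hy, hc', map_zero, sub_zero]
    · exact hz
  let a : X →+ p.ker :=
    ((AddMonoidHom.id G₀ - g.comp p).comp X.subtype).codRestrict p.ker
      (fun x => by simp [AddMonoidHom.mem_ker, hp])
  let i' : X →+ p.ker × (G₁ ⧸ K) := a.prod ((q.comp p).comp X.subtype)
  have ha : ∀ x : X, ((i' x).1 : G₀) = x - g (p x) := fun x => rfl
  have hb : ∀ x : X, (i' x).2 = q (p x) := fun x => rfl
  have hi' : Function.Injective i' := by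
    rw [injective_iff_map_eq_zero]
    intro x hx
    have h1 := ha x
    have h2 := hb x
    rw [hx] at h1 h2
    obtain ⟨x', hx', hpx⟩ := hX3 x x.2
    have h3 : i ⟨x', hx'⟩ = 0 := by rw [← hqf]; rw [hpx] at h2; exact h2.symm
    have h4 : x' = 0 := congrArg Subtype.val ((map_eq_zero_iff i hi).1 h3)
    rw [hpx, h4] at h1
    ext
    simpa using h1.symm
  have hess' : ∀ e : p.ker × (G₁ ⧸ K), e ≠ 0 → ∃ (n : ℤ) (x : X), n • e = i' x ∧ x ≠ 0 := by
    rintro ⟨⟨c, hc⟩, e⟩ hne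
    have hc' : p c = 0 := hc
    by_cases he : e = 0
    · subst he
      refine ⟨1, ⟨c, hX1 c hc⟩, ?_, ?_⟩
      · rw [one_smul]
        ext
        · rw [ha]; simp [hc']
        · rw [hb]; simp [hc']
      · intro h
        have : c = 0 := congrArg Subtype.val h
        subst this
        exact hne rfl
    · obtain ⟨n, x, hn, hx⟩ := hess e he
      have hpp : p (n • c + g (f x)) = f x := by
        rw [map_add, map_zsmul, hc', smul_zero, zero_add, hp]
      refine ⟨n, ⟨n • c + g (f x), X.add_mem (X.zsmul_mem (hX1 c hc) n) (hX2 x x.2)⟩, ?_, ?_⟩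
      · ext
        · rw [ha]
          show n • c = n • c + g (f x) - g (p (n • c + g (f x)))
          rw [hpp, add_sub_cancel_right]
        · rw [hb]
          show n • e = q (p (n • c + g (f x)))
          rw [hpp, hqf, hn]
      · intro h
        have h5 : n • c + g (f x) = 0 := congrArg Subtype.val h
        rw [h5, map_zero] at hpp
        exact hx (Subtype.ext ((map_eq_zero_iff f hf).1 hpp.symm))
  obtain ⟨e1⟩ := sbd_unique hC hE i' hi' i hi hess' hess
  obtain ⟨e2⟩ := sbd_retract g p hp
  obtain ⟨e3⟩ := sbd_retract j q hqj
  exact ⟨e2.trans <| ((AddEquiv.refl _).prodCongr (e3.trans AddEquiv.prodComm)).trans <|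
    AddEquiv.prodAssoc.symm.trans <| (e1.prodCongr (AddEquiv.refl _)).trans <|
    AddEquiv.prodComm.trans e3.symm⟩
end

section
/- Let I and J be index types, let m : I → ℕ and n : J → ℕ satisfy m i > 0 and n j > 0 for all i and j, and let G = ⨁_{i∈I} ℤ/(m i) and H = ⨁_{j∈J} ℤ/(n j) be the corresponding direct sums of finite cyclic groups. If there exist pure injective group homomorphisms f : G → H and g : H → G, then G and H are isomorphic as groups. (This is the Schröder–Bernstein property for direct sums of finite cyclic groups with pure embeddings as arrows.) -/
open DirectSum

/-- An (injective) additive group homomorphism `f : A →+ B` is pure if whenever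
`f a` is divisible by `n` in `B`, then `a` is divisible by `n` in `A`. -/
def IsPureHom {A B : Type*} [AddCommGroup A] [AddCommGroup B] (f : A →+ B) : Prop :=
  ∀ (n : ℕ) (a : A) (b : B), f a = n • b → ∃ a' : A, a = n • a'

theorem sb_coord (p k n : ℕ) (hp : p.Prime) (hn : IsPrimePow n) (c : ℕ)
    (h0 : n ∣ p ^ (k + 1) * c) (h1 : n = p ^ (k + 1) → p ∣ c) :
    ∃ b : ZMod n, p ^ k • (c : ZMod n) = p ^ (k + 1) • b := by
  by_cases hc : p ∣ c
  · obtain ⟨d, rfl⟩ := hc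
    refine ⟨(d : ZMod n), ?_⟩
    simp only [nsmul_eq_mul]
    push_cast
    ring
  · refine ⟨0, ?_⟩
    have key : n ∣ p ^ k * c := by
      rw [isPrimePow_nat_iff] at hn
      obtain ⟨l, a, hl, ha, rfl⟩ := hn
      by_cases hlp : l = p
      · subst hlp
        have hcop : Nat.Coprime (l ^ a) c := Nat.Coprime.pow_left _ ((Nat.Prime.coprime_iff_not_dvd hl).2 hc)
        have h2 : l ^ a ∣ l ^ (k + 1) := hcop.dvd_of_dvd_mul_right h0
        have h3 : a ≤ k + 1 := (Nat.pow_dvd_pow_iff_le_right hl.one_lt).1 h2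
        have h4 : a ≠ k + 1 := fun h => hc (h1 (by rw [h]))
        exact Dvd.dvd.mul_right (pow_dvd_pow _ (by omega)) _
      · have hcop : Nat.Coprime (l ^ a) (p ^ (k + 1)) :=
          Nat.Coprime.pow _ _ ((Nat.coprime_primes hl hp).2 hlp)
        exact Dvd.dvd.mul_left (hcop.dvd_of_dvd_mul_left h0) _
    rw [smul_zero, nsmul_eq_mul, ← Nat.cast_mul]
    exact (ZMod.natCast_eq_zero_iff _ _).2 key

theorem sb_divisible_s1 {J : Type*} (n : J → ℕ) (N : ℕ) (x : ⨁ j, ZMod (n j))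
    (h : ∀ j, ∃ b : ZMod (n j), x j = N • b) : ∃ b : ⨁ j, ZMod (n j), x = N • b := by
  classical
  choose b hb using h
  refine ⟨∑ j ∈ DFinsupp.support x, DirectSum.of (fun j => ZMod (n j)) j (b j), ?_⟩
  conv_lhs => rw [← DirectSum.sum_support_of x]
  rw [Finset.smul_sum]
  refine Finset.sum_congr rfl fun j _ => ?_
  rw [hb j, map_nsmul]

open Classical in
noncomputable def sbRho {J : Type*} (n : J → ℕ) (p q : ℕ) (hpq : p ∣ q) :
    (⨁ j, ZMod (n j)) →+ ({j // n j = q} →₀ ZMod p) :=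
  DirectSum.toAddMonoid fun j =>
    if h : n j = q then
      (Finsupp.singleAddHom (⟨j, h⟩ : {j // n j = q})).comp
        (ZMod.castHom (h.symm ▸ hpq : p ∣ n j) (ZMod p)).toAddMonoidHom
    else 0

theorem sbRho_apply {J : Type*} (n : J → ℕ) (p q : ℕ) (hpq : p ∣ q)
    (z : ⨁ j, ZMod (n j)) (j : {j // n j = q}) :
    sbRho n p q hpq z j = ZMod.castHom (j.2.symm ▸ hpq : p ∣ n j) (ZMod p) (z j) := by
  classical
  induction z using DirectSum.induction_on with
  | zero => simp
  | add x y hx hy =>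
    rw [map_add, Finsupp.add_apply, hx, hy, DirectSum.add_apply, map_add]
  | of i x =>
    rw [sbRho, DirectSum.toAddMonoid_of]
    obtain ⟨j, hj⟩ := j
    by_cases hij : i = j
    · subst hij
      rw [dif_pos hj]
      simp
    · rw [DirectSum.of_eq_of_ne _ _ _ (Ne.symm hij)]
      split_ifs with h
      · simp [Finsupp.single_apply, hij]
      · simp

theorem sb_embed {I J : Type*} (m : I → ℕ) (n : J → ℕ)
    (hn : ∀ j, IsPrimePow (n j))
    (f : (⨁ i, ZMod (m i)) →+ ⨁ j, ZMod (n j)) (hf : IsPureHom f)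
    (p k : ℕ) (hp : p.Prime) :
    Nonempty ({i // m i = p ^ (k + 1)} ↪ {j // n j = p ^ (k + 1)}) := by
  classical
  have : Fact p.Prime := ⟨hp⟩
  have hpq : p ∣ p ^ (k + 1) := dvd_pow_self _ (Nat.succ_ne_zero _)
  let e : {i // m i = p ^ (k + 1)} → ⨁ i, ZMod (m i) :=
    fun i => DirectSum.of (fun i => ZMod (m i)) i.1 1
  let v : {i // m i = p ^ (k + 1)} → ({j // n j = p ^ (k + 1)} →₀ ZMod p) :=
    fun i => sbRho n p _ hpq (f (e i))
  have hv : LinearIndependent (ZMod p) v := by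
    rw [linearIndependent_iff']
    intro s c hc i hi
    let y : ⨁ i, ZMod (m i) := ∑ i ∈ s, (c i).val • e i
    have hy0 : p ^ (k + 1) • y = 0 := by
      rw [Finset.smul_sum]
      refine Finset.sum_eq_zero fun i _ => ?_
      rw [smul_comm, ← map_nsmul]
      have : p ^ (k + 1) • (1 : ZMod (m i.1)) = 0 := by
        rw [nsmul_eq_mul, mul_one]
        exact (ZMod.natCast_eq_zero_iff _ _).2 (by rw [i.2])
      rw [this]; simp
    have hrho : sbRho n p _ hpq (f y) = 0 := by
      rw [← hc, map_sum, map_sum]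
      refine Finset.sum_congr rfl fun i _ => ?_
      rw [map_nsmul, map_nsmul, ← Nat.cast_smul_eq_nsmul (ZMod p), ZMod.natCast_zmod_val]
    have hdiv : ∃ b, p ^ k • f y = p ^ (k + 1) • b := by
      apply sb_divisible_s1
      intro j
      have hnj : NeZero (n j) := ⟨(hn j).ne_zero⟩
      have hz : (f y j) = (((f y j).val : ℕ) : ZMod (n j)) := (ZMod.natCast_zmod_val _).symm
      have h0 : p ^ (k + 1) • (f y j) = 0 := by
        have := congrArg (fun t => f t j) hy0
        simpa only [map_nsmul, map_zero, DirectSum.smul_apply, DirectSum.zero_apply] using this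
      rw [DirectSum.smul_apply, hz]
      apply sb_coord p k (n j) hp (hn j)
      · rw [← ZMod.natCast_eq_zero_iff, Nat.cast_mul, ← hz, ← nsmul_eq_mul, h0]
      · intro hj
        have h1 := sbRho_apply n p _ hpq (f y) ⟨j, hj⟩
        rw [hrho] at h1
        dsimp only at h1
        rw [hz, map_natCast] at h1
        exact (ZMod.natCast_eq_zero_iff _ _).1 h1.symm
    obtain ⟨b, hb⟩ := hdiv
    rw [← map_nsmul] at hb
    obtain ⟨a, ha⟩ := hf _ _ _ hb
    have hyi : y i.1 = ((c i).val : ZMod (m i.1)) := by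
      have : y i.1 = ∑ t ∈ s, ((c t).val • e t) i.1 := by
        simp only [y]
        exact map_sum (DFinsupp.evalAddMonoidHom (β := fun i => ZMod (m i)) i.1) _ _
      rw [this, Finset.sum_eq_single_of_mem i hi]
      · rw [DirectSum.smul_apply, DirectSum.of_eq_same, nsmul_eq_mul, mul_one]
      · intro t _ hti
        rw [DirectSum.smul_apply, DirectSum.of_eq_of_ne _ _ _ (fun h => hti (Subtype.ext h.symm)), smul_zero]
    have h2 := congrArg (fun t => t i.1) ha
    simp only [DirectSum.smul_apply] at h2
    have h3 : p ^ (k + 1) • (a i.1) = 0 := by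
      rw [nsmul_eq_mul, (ZMod.natCast_eq_zero_iff _ _).2 (by rw [i.2]), zero_mul]
    rw [h3, hyi, nsmul_eq_mul, ← Nat.cast_mul, ZMod.natCast_eq_zero_iff, i.2, pow_succ] at h2
    have h4 := Nat.dvd_of_mul_dvd_mul_left (pow_pos hp.pos k) h2
    rw [← ZMod.natCast_zmod_val (c i)]
    exact (ZMod.natCast_eq_zero_iff _ _).2 h4
  have := hv.cardinal_lift_le_rank
  rw [rank_finsupp_self] at this
  simp only [Cardinal.lift_lift, Cardinal.lift_id, Cardinal.lift_umax] at this
  exact Cardinal.lift_mk_le'.1 (by simpa using this)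

theorem sb_primary {I : Type*} (m : I → ℕ) (hm : ∀ i, 0 < m i) :
    ∃ q : (Σ i : I, (m i).primeFactors) → ℕ, (∀ s, IsPrimePow (q s)) ∧
      Nonempty ((⨁ i, ZMod (m i)) ≃+ ⨁ s, ZMod (q s)) := by
  classical
  refine ⟨fun s => (s.2 : ℕ) ^ ((m s.1).factorization s.2), ?_, ⟨?_⟩⟩
  · rintro ⟨i, p, hp⟩
    have hpp := Nat.prime_of_mem_primeFactors hp
    exact hpp.isPrimePow.pow (hpp.factorization_pos_of_dvd (hm i).ne'
      (Nat.dvd_of_mem_primeFactors hp)).ne'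
  · refine AddEquiv.trans (DFinsupp.mapRange.addEquiv fun i => ?_)
      (DirectSum.sigmaCurryEquiv (δ := fun i (p : (m i).primeFactors) =>
        ZMod ((p : ℕ) ^ ((m i).factorization p)))).symm
    exact (ZMod.equivPi _ (hm i).ne').toAddEquiv.trans (DirectSum.addEquivProd _).symm

theorem sb_pure_conj {A B A' B' : Type*} [AddCommGroup A] [AddCommGroup B] [AddCommGroup A']
    [AddCommGroup B'] (f : A →+ B) (hf : IsPureHom f) (a : A ≃+ A') (b : B ≃+ B') :
    IsPureHom ((b.toAddMonoidHom.comp f).comp a.symm.toAddMonoidHom) := by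
  intro n x y h
  have h' : b (f (a.symm x)) = n • y := h
  have h2 : f (a.symm x) = n • b.symm y := by
    rw [← map_nsmul, ← h', b.symm_apply_apply]
  obtain ⟨z, hz⟩ := hf n _ _ h2
  exact ⟨a z, by rw [← map_nsmul, ← hz, a.apply_symm_apply]⟩

theorem sb_prime_pow {I J : Type*} (m : I → ℕ) (n : J → ℕ)
    (hm : ∀ i, IsPrimePow (m i)) (hn : ∀ j, IsPrimePow (n j))
    (f : (⨁ i, ZMod (m i)) →+ ⨁ j, ZMod (n j)) (hf : IsPureHom f)
    (g : (⨁ j, ZMod (n j)) →+ ⨁ i, ZMod (m i)) (hg : IsPureHom g) :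
    Nonempty ((⨁ i, ZMod (m i)) ≃+ ⨁ j, ZMod (n j)) := by
  classical
  have key : ∀ q, Nonempty ({i // m i = q} ≃ {j // n j = q}) := by
    intro q
    by_cases hq : IsPrimePow q
    · rw [isPrimePow_nat_iff] at hq
      obtain ⟨p, k, hp, hk, rfl⟩ := hq
      obtain ⟨k, rfl⟩ : ∃ l, k = l + 1 := ⟨k - 1, by omega⟩
      obtain ⟨u⟩ := sb_embed m n hn f hf p k hp
      obtain ⟨w⟩ := sb_embed n m hm g hg p k hp
      exact Function.Embedding.antisymm u w
    · have : IsEmpty {i // m i = q} := ⟨fun i => hq (i.2 ▸ hm i.1)⟩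
      have : IsEmpty {j // n j = q} := ⟨fun i => hq (i.2 ▸ hn i.1)⟩
      exact ⟨Equiv.equivOfIsEmpty _ _⟩
  let e : I ≃ J := Equiv.ofFiberEquiv (f := m) (g := n) fun q => (key q).some
  have he : ∀ j, m (e.symm j) = n j := fun j => by
    rw [← Equiv.ofFiberEquiv_map (f := m) (g := n) (fun q => (key q).some) (e.symm j)]
    exact congrArg n (e.apply_symm_apply j)
  exact ⟨(DirectSum.equivCongrLeft e).trans
    (DFinsupp.mapRange.addEquiv fun j => (ZMod.ringEquivCongr (he j)).toAddEquiv)⟩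

/-- The Schröder–Bernstein property for direct sums of finite cyclic groups with
pure embeddings as arrows. -/
theorem sb_direct_sums_of_cyclic {I J : Type*} (m : I → ℕ) (n : J → ℕ)
    (hm : ∀ i, 0 < m i) (hn : ∀ j, 0 < n j)
    (f : (⨁ i, ZMod (m i)) →+ ⨁ j, ZMod (n j))
    (hf : Function.Injective f) (hfpure : IsPureHom f)
    (g : (⨁ j, ZMod (n j)) →+ ⨁ i, ZMod (m i))
    (hg : Function.Injective g) (hgpure : IsPureHom g) :
    Nonempty ((⨁ i, ZMod (m i)) ≃+ ⨁ j, ZMod (n j)) := by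
  obtain ⟨q, hq, ⟨a⟩⟩ := sb_primary m hm
  obtain ⟨r, hr, ⟨b⟩⟩ := sb_primary n hn
  obtain ⟨t⟩ := sb_prime_pow q r hq hr _ (sb_pure_conj f hfpure a b) _ (sb_pure_conj g hgpure b a)
  exact ⟨(a.trans t).trans b.symm⟩
end

section
/- For ℓ ∈ {0,1}, let I_ℓ and J_ℓ be index types, let p_{ℓ,i} (i ∈ I_ℓ) be prime numbers, let n_{ℓ,j} (j ∈ J_ℓ) be positive integers, let D_ℓ be a divisible abelian group, and set G_ℓ = (⨁_{i∈I_ℓ} ℤ_{p_{ℓ,i}}) × (⨁_{j∈J_ℓ} ℤ/(n_{ℓ,j})) × D_ℓ, where ℤ_p denotes the additive group of the p-adic integers. If there exist pure injective group homomorphisms f₀ : G₀ → G₁ and f₁ : G₁ → G₀, then G₀ and G₁ are isomorphic as groups. (This is the Schröder–Bernstein property for direct sums of indecomposable pure-injective abelian groups with pure embeddings as arrows.) -/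
open DirectSum

theorem div_ext {M N Q : Type*} [AddCommGroup M] [AddCommGroup N] [AddCommGroup Q]
    (hQ : IsDivisibleGroup Q) (f : M →+ N) (hf : Function.Injective f) (g : M →+ Q) :
    ∃ h : N →+ Q, ∀ x, h (f x) = g x := by
  let _ : DivisibleBy Q ℕ := divisibleByOfSMulRightSurj Q ℕ
    (fun {n} hn d => hQ d n hn)
  let _ : DivisibleBy Q ℤ := AddGroup.divisibleByIntOfDivisibleByNat Q
  obtain ⟨h, hh⟩ := (Module.Baer.of_divisible Q).extension_property_addMonoidHom f hf g
  exact ⟨h, fun x => DFunLike.congr_fun hh x⟩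

theorem retract_equiv {A S : Type*} [AddCommGroup A] [AddCommGroup S]
    (i : S →+ A) (r : A →+ S) (h : ∀ x, r (i x) = x) : Nonempty (A ≃+ S × r.ker) :=
  ⟨{ toFun := fun a => (r a, ⟨a - i (r a), by simp [AddMonoidHom.mem_ker, h]⟩)
     invFun := fun x => i x.1 + x.2
     left_inv := fun a => by simp
     right_inv := fun ⟨x, y, hy⟩ => by
       have hy' : r y = 0 := hy
       ext <;> simp [h, hy']
     map_add' := fun a b => by
       ext
       · simp
       · simp; abel }⟩

theorem div_of_prime {Q : Type*} [AddCommGroup Q]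
    (h : ∀ (d : Q) (n : ℕ), n.Prime → ∃ y : Q, n • y = d) : IsDivisibleGroup Q := by
  intro d n
  induction n using Nat.recOnMul generalizing d with
  | zero => intro h; exact absurd rfl h
  | one => intro _; exact ⟨d, one_nsmul d⟩
  | prime p hp => intro _; exact h d p hp
  | mul a b ha hb =>
    intro hab
    obtain ⟨y, rfl⟩ := ha d (by rintro rfl; simp at hab)
    obtain ⟨z, rfl⟩ := hb y (by rintro rfl; simp at hab)
    exact ⟨z, mul_nsmul' z a b⟩

theorem ess_hull {F : Type*} [AddCommGroup F] (hF : IsDivisibleGroup F) (X : AddSubgroup F) :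
    ∃ Q : AddSubgroup F, X ≤ Q ∧ IsDivisibleGroup Q ∧
      ∀ x ∈ Q, x ≠ 0 → ∃ n : ℤ, n • x ≠ 0 ∧ n • x ∈ X := by
  obtain ⟨Q, hXQ, hQ⟩ := zorn_le_nonempty₀
    {Q : AddSubgroup F | ∀ x ∈ Q, x ≠ 0 → ∃ n : ℤ, n • x ≠ 0 ∧ n • x ∈ X} (by
      intro c hc hch y hy
      refine ⟨sSup c, ?_, fun z hz => le_sSup hz⟩
      intro x hx
      rw [AddSubgroup.mem_sSup_of_directedOn ⟨y, hy⟩ hch.directedOn] at hx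
      obtain ⟨s, hs, hxs⟩ := hx
      exact hc hs x hxs) X (by
      intro x hx hx0
      exact ⟨1, by simpa using hx0, by simpa using hx⟩)
  have hQe := hQ.prop
  refine ⟨Q, hXQ, ?_, hQe⟩
  apply div_of_prime
  rintro ⟨d, hd⟩ p hp
  obtain ⟨y, hy⟩ := hF d p hp.ne_zero
  suffices ∃ y ∈ Q, p • y = d by
    obtain ⟨y, hyQ, hy⟩ := this
    exact ⟨⟨y, hyQ⟩, Subtype.ext hy⟩
  by_cases hyQ : y ∈ Q
  · exact ⟨y, hyQ, hy⟩
  -- the extension by y is not essential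
  have hne : ¬ ∀ x ∈ Q ⊔ AddSubgroup.zmultiples y, x ≠ 0 →
      ∃ n : ℤ, n • x ≠ 0 ∧ n • x ∈ X := by
    intro hall
    have := hQ.le_of_ge (y := Q ⊔ AddSubgroup.zmultiples y) hall le_sup_left
    exact hyQ (this (AddSubgroup.mem_sup_right (AddSubgroup.mem_zmultiples y)))
  push Not at hne
  obtain ⟨x, hx, hx0, hxn⟩ := hne
  obtain ⟨q, hq, z, hz, rfl⟩ := AddSubgroup.mem_sup.1 hx
  obtain ⟨m, rfl⟩ := AddSubgroup.mem_zmultiples_iff.1 hz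
  have hy' : (p : ℤ) • y = d := by simpa using hy
  have hpx : (p : ℤ) • (q + m • y) ∈ Q := by
    rw [smul_add, smul_comm, hy']
    exact Q.add_mem (Q.zsmul_mem hq _) (Q.zsmul_mem hd _)
  have hpx0 : (p : ℤ) • (q + m • y) = 0 := by
    by_contra h0
    obtain ⟨n, hn0, hn⟩ := hQe _ hpx h0
    rw [smul_smul] at hn0 hn
    exact hxn _ hn0 hn
  have hcop : IsCoprime m (p : ℤ) := by
    rw [isCoprime_comm, Prime.coprime_iff_not_dvd (Nat.prime_iff_prime_int.1 hp)]
    rintro ⟨k, rfl⟩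
    have hxQ : q + ((p : ℤ) * k) • y ∈ Q := by
      rw [mul_comm, mul_smul, hy']
      exact Q.add_mem hq (Q.zsmul_mem hd _)
    obtain ⟨n, hn0, hn⟩ := hQe _ hxQ hx0
    exact hxn n hn0 hn
  obtain ⟨a, b, hab⟩ := hcop
  refine ⟨y - a • (q + m • y), ?_, ?_⟩
  · have : y - a • (q + m • y) = b • d - a • q := by
      have h1 : y = (a * m + b * p) • y := by rw [hab, one_smul]
      nth_rewrite 1 [h1]
      rw [← hy']
      module
    rw [this]
    exact Q.sub_mem (Q.zsmul_mem hd _) (Q.zsmul_mem hq _)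
  · have : (p : ℤ) • (y - a • (q + m • y)) = d := by
      rw [smul_sub, smul_comm (p : ℤ) a, hpx0, hy']; simp
    simpa using this

theorem bumby {E F : Type*} [AddCommGroup E] [AddCommGroup F]
    (hE : IsDivisibleGroup E) (hF : IsDivisibleGroup F)
    (h : E →+ F) (hh : Function.Injective h) (g : F →+ E) (hg : Function.Injective g) :
    Nonempty (E ≃+ F) := by
  obtain ⟨r, hr⟩ := div_ext hF g hg (AddMonoidHom.id F)
  simp only [AddMonoidHom.id_apply] at hr
  let T : AddSubgroup E →o AddSubgroup E :=
    ⟨fun S => r.ker ⊔ S.map (g.comp h), fun S S' hS => sup_le_sup_left (AddSubgroup.map_mono hS) _⟩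
  obtain ⟨P, hP⟩ : ∃ P : AddSubgroup E, r.ker ⊔ P.map (g.comp h) = P := ⟨T.lfp, T.map_lfp⟩
  let X : AddSubgroup F := P.map h
  obtain ⟨Q, hXQ, hQd, hQe⟩ := ess_hull hF X
  -- the map B × X → Q
  have hBP : ∀ (b : r.ker) (x : X), (b : E) + g x ∈ P := by
    rintro ⟨b, hb⟩ ⟨x, hx⟩
    rw [← hP]
    refine AddSubgroup.add_mem_sup hb ?_
    obtain ⟨y, hy, rfl⟩ := hx
    exact ⟨y, hy, rfl⟩
  let u : r.ker × X →+ Q :=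
    { toFun := fun z => ⟨h (z.1 + g z.2), hXQ ⟨_, hBP z.1 z.2, rfl⟩⟩
      map_zero' := by ext; simp
      map_add' := fun a b => by ext; simp; abel }
  have hu : ∀ z, u z = 0 → z = 0 := by
    rintro ⟨b, x⟩ hz
    have h1 : h ((b : E) + g x) = 0 := congrArg Subtype.val hz
    have h2 : (b : E) + g x = 0 := (injective_iff_map_eq_zero h).1 hh _ h1
    have h3 : r ((b : E) + g x) = 0 := by rw [h2, map_zero]
    have hb : r (b : E) = 0 := b.2
    rw [map_add, hb, hr, zero_add] at h3
    have h4 : (b : E) = 0 := by simpa [h3] using h2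
    ext
    · simpa using h4
    · simpa using h3
  let j : r.ker × X →+ r.ker × Q :=
    AddMonoidHom.prodMap (AddMonoidHom.id _) (AddSubgroup.inclusion hXQ)
  have hj : Function.Injective j :=
    Function.Injective.prodMap Function.injective_id (AddSubgroup.inclusion_injective hXQ)
  obtain ⟨φ, hφ⟩ := div_ext hQd j hj u
  have hφi : ∀ z, φ z = 0 → z = 0 := by
    rintro ⟨b, q⟩ hz
    by_contra h0
    have key : ∃ n : ℤ, n • ((b, q) : r.ker × Q) ≠ 0 ∧ ∃ w, j w = n • ((b, q) : r.ker × Q) := by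
      by_cases hq : q = 0
      · subst hq
        exact ⟨1, by simpa using h0, (b, 0), by simp [j]⟩
      · obtain ⟨n, hn0, hn⟩ := hQe q q.2 (by simpa using hq)
        refine ⟨n, ?_, (n • b, ⟨n • (q : F), hn⟩), ?_⟩
        · intro hh
          exact hn0 (congrArg Subtype.val (congrArg Prod.snd hh))
        · rfl
    obtain ⟨n, hn0, w, hw⟩ := key
    have : u w = 0 := by rw [← hφ, hw, map_zsmul, hz, smul_zero]
    rw [hu w this, map_zero] at hw
    exact hn0 hw.symm
  have hφs : Function.Surjective φ := by
    have hdiv : IsDivisibleGroup φ.range := by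
      rintro ⟨_, ⟨b, q⟩, rfl⟩ n hn
      obtain ⟨e, he⟩ := hE b n hn
      obtain ⟨q', hq'⟩ := hQd q n hn
      refine ⟨⟨φ (⟨e - g (r e), by simp [AddMonoidHom.mem_ker, hr]⟩, q'), _, rfl⟩, ?_⟩
      ext1
      change n • φ _ = φ _
      rw [← map_nsmul]
      congr 1
      ext1
      · ext
        have hb : r (b : E) = 0 := b.2
        simp [smul_sub, he, ← map_nsmul, hb]
      · simp [hq']
    obtain ⟨t, ht⟩ := div_ext hdiv φ.range.subtype Subtype.val_injective (AddMonoidHom.id _)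
    simp only [AddMonoidHom.id_apply] at ht
    have htX : ∀ (y : Q), (y : F) ∈ X → ((t y : φ.range) : Q) = y := by
      intro y hy
      have : y ∈ φ.range := by
        obtain ⟨p, hp, hpy⟩ := hy
        have hp' := hp
        rw [← hP] at hp'
        obtain ⟨b, hb, c, ⟨d, hd, rfl⟩, rfl⟩ := AddSubgroup.mem_sup.1 hp'
        refine ⟨j (⟨b, hb⟩, ⟨h d, d, hd, rfl⟩), ?_⟩
        rw [hφ]
        ext
        exact hpy
      exact congrArg Subtype.val (ht ⟨y, this⟩)
    have hti : ∀ y, t y = 0 → y = 0 := by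
      intro y hy
      by_contra h0
      obtain ⟨n, hn0, hn⟩ := hQe y y.2 (by simpa using h0)
      have h1 := htX (n • y) hn
      rw [map_zsmul, hy, smul_zero] at h1
      exact hn0 (congrArg Subtype.val h1.symm)
    intro y
    have h1 : t ((t y : Q) - y) = 0 := by
      rw [map_sub]
      exact sub_eq_zero.2 (ht (t y))
    have h2 := sub_eq_zero.1 (hti _ h1)
    obtain ⟨z, hz⟩ := (t y).2
    exact ⟨z, hz.trans h2⟩
  let e1 : r.ker × Q ≃+ Q := AddEquiv.ofBijective φ
    ⟨(injective_iff_map_eq_zero φ).2 hφi, hφs⟩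
  obtain ⟨s, hs⟩ := div_ext hQd Q.subtype Subtype.val_injective (AddMonoidHom.id _)
  obtain ⟨e2⟩ := retract_equiv g r hr
  obtain ⟨e3⟩ := retract_equiv Q.subtype s hs
  -- E ≃ F × B ≃ (Q × R) × B ≃ (B × Q) × R ≃ Q × R ≃ F
  exact ⟨e2.trans (AddEquiv.prodComm.trans (((AddEquiv.refl _).prodCongr e3).trans
    (AddEquiv.prodAssoc.symm.trans ((e1.prodCongr (AddEquiv.refl _)).trans e3.symm))))⟩

theorem icz (a : ℤ) (b : ℕ) : ((a : ℤ) : ZMod b) = 0 ↔ (b : ℤ) ∣ a :=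
  CharP.intCast_eq_zero_iff (ZMod b) b a

theorem zmod_kill (n m : ℕ) (h : n = m) (x : ZMod n) : m • x = 0 := by
  subst h; simp

theorem ds_smul {I : Type*} {M : I → Type*} [∀ i, AddCommGroup (M i)] (n : ℕ)
    (z : ⨁ i, M i) (i : I) : (n • z) i = n • z i := rfl

theorem card_embed {p : ℕ} [Fact p.Prime] {S S' : Type*} (v : S → (S' →₀ ZMod p))
    (h : ∀ c : S →₀ ℤ, (c.sum fun s n => n • v s) = 0 → ∀ s, (p : ℤ) ∣ c s) :
    Nonempty (S ↪ S') := by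
  have hli : LinearIndependent (ZMod p) v := by
    rw [linearIndependent_iff]
    intro l hl
    have := h (l.mapRange (fun a => (a.val : ℤ)) (by simp)) (by
      rw [Finsupp.sum_mapRange_index (by simp)]
      rw [Finsupp.linearCombination_apply] at hl
      rw [← hl]
      apply Finsupp.sum_congr
      intro s _
      rw [← Int.cast_smul_eq_zsmul (ZMod p)]
      simp)
    ext s
    have h1 := this s
    rw [Finsupp.mapRange_apply, ← icz] at h1
    simpa using h1
  have h1 := hli.cardinal_lift_le_rank
  rw [rank_finsupp_self] at h1
  simpa [Cardinal.lift_mk_le'] using h1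

theorem exists_pi {I : Type*} {M : I → Type*} [∀ i, AddCommGroup (M i)] {A : Type*}
    [AddCommGroup A] (P : I → Prop) (ρ : ∀ i, P i → (M i →+ A)) :
    ∃ π : (⨁ i, M i) →+ ({i // P i} →₀ A), ∀ z i, π z i = ρ i.1 i.2 (z i.1) := by
  classical
  refine ⟨DirectSum.toAddMonoid fun i => if h : P i then
    (Finsupp.singleAddHom (⟨i, h⟩ : {i // P i})).comp (ρ i h) else 0, ?_⟩
  rintro z ⟨i, hi⟩
  induction z using DirectSum.induction_on with
  | zero => simp
  | of j x =>
    rw [DirectSum.toAddMonoid_of]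
    by_cases hj : P j
    · rw [dif_pos hj]
      by_cases hij : j = i
      · subst hij; simp
      · rw [DirectSum.of_eq_of_ne _ _ _ (Ne.symm hij)]
        simp [hij]
    · have hij : j ≠ i := by rintro rfl; exact hj hi
      rw [dif_neg hj, DirectSum.of_eq_of_ne _ _ _ (Ne.symm hij)]
      simp
  | add x y hx hy => rw [map_add, Finsupp.add_apply, hx, hy, DirectSum.add_apply, map_add]

theorem ds_divis {I : Type*} {M : I → Type*} [∀ i, AddCommGroup (M i)] (n : ℕ)
    (z : ⨁ i, M i) (h : ∀ i, ∃ y, z i = n • y) : ∃ w : ⨁ i, M i, z = n • w := by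
  classical
  choose y hy using h
  refine ⟨DirectSum.mk M (DFinsupp.support z) (fun i => y i), ?_⟩
  ext i
  rw [DirectSum.smul_apply]
  by_cases hi : i ∈ DFinsupp.support z
  · rw [DirectSum.mk_apply_of_mem hi, hy]
  · rw [DirectSum.mk_apply_of_notMem hi, DFinsupp.notMem_support_iff.1 hi, smul_zero]

theorem ds_tors {K : Type*} (N : K → ℕ) (hN : ∀ k, 0 < N k) (z : ⨁ k, ZMod (N k)) :
    ∃ m : ℕ, m ≠ 0 ∧ m • z = 0 := by
  classical
  induction z using DirectSum.induction_on with
  | zero => exact ⟨1, one_ne_zero, by simp⟩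
  | of i x =>
    refine ⟨N i, (hN i).ne', ?_⟩
    rw [← map_nsmul]; simp
  | add x y hx hy =>
    obtain ⟨a, ha, hax⟩ := hx
    obtain ⟨b, hb, hby⟩ := hy
    refine ⟨a * b, mul_ne_zero ha hb, ?_⟩
    rw [smul_add, mul_smul, mul_smul, hby, smul_comm, hax]; simp

theorem ds_coord {I : Type*} [DecidableEq I] {M : I → Type*} [∀ i, AddCommGroup (M i)]
    (P : I → Prop) (e : ∀ i, M i) (c : {i // P i} →₀ ℤ) (s : {i // P i}) :
    (c.sum fun s n => n • DirectSum.of M s.1 (e s.1)) s.1 = c s • e s.1 := by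
  have : ∀ z : ⨁ i, M i, z s.1 = (DFinsupp.evalAddMonoidHom s.1 : (⨁ i, M i) →+ M s.1) z :=
    fun _ => rfl
  rw [this, map_finsuppSum, Finsupp.sum, Finset.sum_eq_single s]
  · rw [← this, DirectSum.smul_apply, DirectSum.of_eq_same]
  · intro b _ hb
    rw [← this, DirectSum.smul_apply, DirectSum.of_eq_of_ne, smul_zero]
    intro h; exact hb (Subtype.ext h.symm)
  · intro h
    simp [Finsupp.notMem_support_iff.1 h]

theorem padic_rho (p q : ℕ) [Fact p.Prime] (h : p = q) :
    ∃ ρ : ℤ_[p] →+ ZMod q, (∀ n : ℤ, ρ n = n) ∧ ∀ x, ρ x = 0 → ∃ y, x = q • y := by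
  subst h
  refine ⟨(PadicInt.toZMod (p := p)).toAddMonoidHom, fun n => by simp, fun x hx => ?_⟩
  have : x ∈ RingHom.ker (PadicInt.toZMod (p := p)) := hx
  rw [PadicInt.ker_toZMod, PadicInt.maximalIdeal_eq_span_p, Ideal.mem_span_singleton] at this
  obtain ⟨y, hy⟩ := this
  exact ⟨y, by rw [hy, nsmul_eq_mul]⟩

theorem padic_other (p q : ℕ) [Fact p.Prime] [hq : Fact q.Prime] (h : p ≠ q) (x : ℤ_[p]) :
    ∃ y, x = q • y := by
  have hu : IsUnit (q : ℤ_[p]) := by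
    rw [PadicInt.isUnit_iff, PadicInt.norm_natCast_eq_one_iff]
    exact (Nat.coprime_primes Fact.out hq.out).2 h
  obtain ⟨u, hu⟩ := hu
  exact ⟨(↑u⁻¹ : ℤ_[p]) * x, by rw [nsmul_eq_mul, ← hu, Units.mul_inv_cancel_left]⟩

theorem padic_red (p : ℕ) [hp : Fact p.Prime] (x : ℤ_[p])
    (h : ∀ n : ℕ, n ≠ 0 → ∃ y, x = n • y) : x = 0 := by
  rw [← PadicInt.ext_of_toZModPow]
  intro n
  obtain ⟨y, hy⟩ := h (p ^ n) (pow_ne_zero _ hp.out.ne_zero)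
  rw [hy, nsmul_eq_mul, map_mul, map_natCast]
  simp

theorem zmod_rho (n q k : ℕ) (h : n = q ^ (k + 1)) :
    ∃ ρ : ZMod n →+ ZMod q, ∀ x, ρ x = 0 → ∃ y, x = q • y := by
  subst h
  refine ⟨(ZMod.castHom (dvd_pow_self q (Nat.succ_ne_zero k)) (ZMod q)).toAddMonoidHom,
    fun x hx => ?_⟩
  obtain ⟨m, rfl⟩ := ZMod.intCast_surjective x
  have hx' : ((m : ℤ) : ZMod q) = 0 := by simpa using hx
  rw [icz] at hx'
  obtain ⟨t, rfl⟩ := hx'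
  exact ⟨(t : ZMod _), by simp⟩

theorem zmod_step (r l q k : ℕ) (hr : r.Prime) (hq : q.Prime) (x : ZMod (r ^ l))
    (hx : q ^ (k + 1) • x = 0) (hy : r ^ l = q ^ (k + 1) → ∃ y, x = q • y) :
    ∃ y, q ^ k • x = q ^ (k + 1) • y := by
  have hred : (∃ y, x = q • y) → ∃ y, q ^ k • x = q ^ (k + 1) • y := by
    rintro ⟨y, rfl⟩
    exact ⟨y, by rw [smul_smul, pow_succ]⟩
  obtain ⟨m, rfl⟩ := ZMod.intCast_surjective x
  have hd : ((r ^ l : ℕ) : ℤ) ∣ (q : ℤ) ^ (k + 1) * m := by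
    rw [← icz]
    simpa using hx
  by_cases hrq : r = q
  · subst hrq
    rcases lt_trichotomy l (k + 1) with h | h | h
    · refine ⟨0, ?_⟩
      obtain ⟨t, ht⟩ := Nat.exists_eq_add_of_le (Nat.lt_succ_iff.1 h)
      have : ((r ^ k : ℕ) : ZMod (r ^ l)) = 0 := by
        rw [ZMod.natCast_eq_zero_iff]; exact pow_dvd_pow _ (by omega)
      rw [nsmul_eq_mul, this]; simp
    · exact hred (hy (by rw [h]))
    · apply hred
      obtain ⟨t, rfl⟩ := Nat.exists_eq_add_of_lt h
      have h2 : (r : ℤ) ^ (k + 1) * (r : ℤ) ^ (t + 1) ∣ (r : ℤ) ^ (k + 1) * m := by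
        rw [← pow_add]; push_cast at hd; rwa [← add_assoc]
      have h3 := Int.dvd_of_mul_dvd_mul_left (pow_ne_zero _ (by exact_mod_cast hr.ne_zero)) h2
      obtain ⟨s, rfl⟩ := (dvd_pow_self (r : ℤ) (Nat.succ_ne_zero t)).trans h3
      exact ⟨(s : ZMod _), by simp⟩
  · refine ⟨0, ?_⟩
    have hc : IsCoprime ((r ^ l : ℕ) : ℤ) ((q : ℤ) ^ (k + 1)) := by
      have := Nat.isCoprime_iff_coprime.2
        (Nat.Coprime.pow l (k + 1) ((Nat.coprime_primes hr hq).2 hrq))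
      exact_mod_cast this
    have := hc.dvd_of_dvd_mul_left hd
    rw [(icz _ _).2 this]; simp

section main
variable {I₀ I₁ K₀ K₁ : Type*}
    (p₀ : I₀ → ℕ) (p₁ : I₁ → ℕ) [∀ i, Fact (p₀ i).Prime] [∀ i, Fact (p₁ i).Prime]
    (n₀ : K₀ → ℕ) (n₁ : K₁ → ℕ)
    (D₀ D₁ : Type*) [AddCommGroup D₀] [AddCommGroup D₁]
    (f : ((⨁ i, PadicInt (p₀ i)) × (⨁ j, ZMod (n₀ j)) × D₀) →+
      ((⨁ i, PadicInt (p₁ i)) × (⨁ j, ZMod (n₁ j)) × D₁))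

theorem embI (hD₁ : IsDivisibleGroup D₁) (hn₁ : ∀ k, 0 < n₁ k) (hf : IsPureHom f)
    (q : ℕ) [hq : Fact q.Prime] :
    Nonempty ({i // p₀ i = q} ↪ {i // p₁ i = q}) := by
  classical
  choose ρ hρ1 hρ using fun i (h : p₁ i = q) => padic_rho (p₁ i) q h
  obtain ⟨π, hπ⟩ := exists_pi (fun i => p₁ i = q) ρ
  let ι := AddMonoidHom.inl (⨁ i, PadicInt (p₀ i)) ((⨁ j, ZMod (n₀ j)) × D₀)
  refine card_embed (p := q)
    (fun s => π (f (ι (DirectSum.of (fun i => ℤ_[p₀ i]) s.1 1))).1) ?_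
  intro c hc s
  set z := c.sum fun s n => n • DirectSum.of (fun i => ℤ_[p₀ i]) s.1 1 with hz
  have h0 : π (f (ι z)).1 = 0 := by
    rw [← hc]
    have := map_finsuppSum ((π.comp (AddMonoidHom.fst _ _)).comp (f.comp ι)) c
      (fun s n => n • DirectSum.of (fun i => ℤ_[p₀ i]) s.1 1)
    simp only [map_zsmul] at this
    exact this
  obtain ⟨w, hw⟩ := ds_divis q (f (ι z)).1 (by
    intro i
    by_cases hi : p₁ i = q
    · apply hρ i hi
      have := hπ (f (ι z)).1 ⟨i, hi⟩
      rw [h0] at this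
      exact this.symm
    · exact padic_other _ _ hi _)
  obtain ⟨m, hm0, hm⟩ := ds_tors n₁ hn₁ (f (ι z)).2.1
  obtain ⟨d, hd⟩ := hD₁ (f (ι z)).2.2 q hq.out.ne_zero
  obtain ⟨a, ha⟩ := hf (m * q) (m • ι z) (w, 0, d) (by
    rw [map_nsmul]
    refine Prod.ext ?_ (Prod.ext ?_ ?_)
    · simp [mul_smul, hw]
    · simpa using hm
    · simp [mul_smul, hd])
  have h1 : m • z = (m * q) • a.1 := congrArg Prod.fst ha
  have h2 : m • z s.1 = (m * q) • a.1 s.1 := by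
    have := DFunLike.congr_fun h1 s.1
    rwa [ds_smul, ds_smul] at this
  rw [hz, ds_coord (fun i => p₀ i = q) (fun i => (1 : ℤ_[p₀ i])) c s, mul_smul] at h2
  have h3 : c s • (1 : ℤ_[p₀ s.1]) = q • a.1 s.1 := by
    rw [nsmul_eq_mul, nsmul_eq_mul] at h2
    exact mul_left_cancel₀ (Nat.cast_ne_zero.2 hm0) h2
  obtain ⟨σ, hσ, -⟩ := padic_rho (p₀ s.1) q s.2
  have h4 := congrArg σ h3
  rw [zsmul_one, hσ, map_nsmul, nsmul_eq_mul, ZMod.natCast_self, zero_mul] at h4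
  exact (icz _ _).1 h4

theorem embK (hD₁ : IsDivisibleGroup D₁) (hn₁ : ∀ k, IsPrimePow (n₁ k)) (hf : IsPureHom f)
    (q k : ℕ) [hq : Fact q.Prime] :
    Nonempty ({i // n₀ i = q ^ (k + 1)} ↪ {i // n₁ i = q ^ (k + 1)}) := by
  classical
  choose ρ hρ using fun i (h : n₁ i = q ^ (k + 1)) => zmod_rho (n₁ i) q k h
  obtain ⟨π, hπ⟩ := exists_pi (fun i => n₁ i = q ^ (k + 1)) ρ
  let ι := (AddMonoidHom.inr (⨁ i, PadicInt (p₀ i)) ((⨁ j, ZMod (n₀ j)) × D₀)).comp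
    (AddMonoidHom.inl (⨁ j, ZMod (n₀ j)) D₀)
  refine card_embed (p := q)
    (fun s => π (f (ι (DirectSum.of (fun i => ZMod (n₀ i)) s.1 1))).2.1) ?_
  intro c hc s
  set z := c.sum fun s n => n • DirectSum.of (fun i => ZMod (n₀ i)) s.1 1 with hz
  have h0 : π (f (ι z)).2.1 = 0 := by
    rw [← hc]
    have := map_finsuppSum ((π.comp ((AddMonoidHom.fst _ _).comp
      (AddMonoidHom.snd _ _))).comp (f.comp ι)) c
      (fun s n => n • DirectSum.of (fun i => ZMod (n₀ i)) s.1 1)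
    simp only [map_zsmul] at this
    exact this
  have hkz : q ^ (k + 1) • z = 0 := by
    rw [hz, Finsupp.smul_sum, Finsupp.sum]
    apply Finset.sum_eq_zero
    intro i _
    have : q ^ (k + 1) • DirectSum.of (fun i => ZMod (n₀ i)) i.1 1 = 0 := by
      rw [← map_nsmul, zmod_kill _ _ i.2, map_zero]
    rw [smul_comm, this, smul_zero]
  have hky : q ^ (k + 1) • f (ι z) = 0 := by
    rw [← map_nsmul, ← map_nsmul, hkz, map_zero, map_zero]
  have hqk : q ^ (k + 1) ≠ 0 := pow_ne_zero _ hq.out.ne_zero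
  have hy1 : (f (ι z)).1 = 0 := by
    have h1 : q ^ (k + 1) • (f (ι z)).1 = 0 := congrArg Prod.fst hky
    ext i : 1
    have h2 := DFunLike.congr_fun h1 i
    rw [DirectSum.smul_apply, DirectSum.zero_apply, nsmul_eq_mul] at h2
    exact (mul_eq_zero.1 h2).resolve_left (Nat.cast_ne_zero.2 hqk)
  obtain ⟨w, hw⟩ : ∃ w, q ^ k • (f (ι z)).2.1 = q ^ (k + 1) • w := by
    apply ds_divis
    intro i
    have h1 : q ^ (k + 1) • (f (ι z)).2.1 = 0 := congrArg (fun t => t.2.1) hky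
    have h2 := DFunLike.congr_fun h1 i
    rw [DirectSum.smul_apply, DirectSum.zero_apply] at h2
    rw [DirectSum.smul_apply]
    have h3 : n₁ i = q ^ (k + 1) → ∃ y, (f (ι z)).2.1 i = q • y := by
      intro hi
      apply hρ i hi
      have := hπ (f (ι z)).2.1 ⟨i, hi⟩
      rw [h0] at this
      exact this.symm
    generalize (f (ι z)).2.1 i = x at h2 h3 ⊢
    obtain ⟨r, l, hr, hl, hrl⟩ := (isPrimePow_nat_iff _).1 (hn₁ i)
    revert x
    rw [← hrl]
    intro x h2 h3
    exact zmod_step r l q k hr hq.out x h2 h3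
  obtain ⟨d, hd⟩ := hD₁ (q ^ k • (f (ι z)).2.2) (q ^ (k + 1)) hqk
  obtain ⟨a, ha⟩ := hf (q ^ (k + 1)) (q ^ k • ι z) (0, w, d) (by
    rw [map_nsmul]
    refine Prod.ext ?_ (Prod.ext ?_ ?_)
    · simp [hy1]
    · simpa using hw
    · simpa using hd.symm)
  have h1 : q ^ k • z = q ^ (k + 1) • a.2.1 := congrArg (fun t => t.2.1) ha
  have h2 : q ^ k • z s.1 = q ^ (k + 1) • a.2.1 s.1 := by
    have := DFunLike.congr_fun h1 s.1
    rwa [ds_smul, ds_smul] at this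
  rw [hz, ds_coord (fun i => n₀ i = q ^ (k + 1)) (fun i => (1 : ZMod (n₀ i))) c s] at h2
  generalize a.2.1 s.1 = t at h2
  have h3 : q ^ (k + 1) • t = 0 := zmod_kill _ _ s.2 _
  rw [h3, zsmul_one, nsmul_eq_mul] at h2
  have h4 : (((q : ℤ) ^ k * c s : ℤ) : ZMod (n₀ s.1)) = 0 := by
    rw [← h2]; push_cast; rfl
  rw [icz, s.2] at h4
  push_cast at h4
  rw [pow_succ] at h4
  exact Int.dvd_of_mul_dvd_mul_left
    (pow_ne_zero _ (by exact_mod_cast hq.out.ne_zero)) h4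

theorem embD (hD₀ : IsDivisibleGroup D₀) (hn₁ : ∀ k, 0 < n₁ k) (hf : IsPureHom f) :
    ∃ g : D₀ →+ D₁, Function.Injective g := by
  let ι := (AddMonoidHom.inr (⨁ i, PadicInt (p₀ i)) ((⨁ j, ZMod (n₀ j)) × D₀)).comp
    (AddMonoidHom.inr (⨁ j, ZMod (n₀ j)) D₀)
  have hdiv : ∀ d (n : ℕ), n ≠ 0 → ∃ y, f (ι d) = n • y := by
    intro d n hn
    obtain ⟨e, rfl⟩ := hD₀ d n hn
    exact ⟨f (ι e), by rw [map_nsmul, map_nsmul]⟩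
  refine ⟨((AddMonoidHom.snd _ _).comp (AddMonoidHom.snd _ _)).comp (f.comp ι), ?_⟩
  rw [injective_iff_map_eq_zero]
  intro d hd
  have h3 : (f (ι d)).2.2 = 0 := hd
  have h1 : (f (ι d)).1 = 0 := by
    ext i : 1
    apply padic_red
    intro n hn
    obtain ⟨y, hy⟩ := hdiv d n hn
    exact ⟨y.1 i, by rw [hy, Prod.smul_fst, DirectSum.smul_apply]⟩
  have h2 : (f (ι d)).2.1 = 0 := by
    ext i : 1
    obtain ⟨y, hy⟩ := hdiv d (n₁ i) (hn₁ i).ne'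
    rw [hy, Prod.smul_snd, Prod.smul_fst, DirectSum.smul_apply]
    simp
  have h4 : f (ι d) = 0 • (0 : _ × _ × _) := by
    rw [zero_smul]; exact Prod.ext h1 (Prod.ext h2 h3)
  obtain ⟨a, ha⟩ := hf 0 (ι d) _ h4
  rw [zero_smul] at ha
  exact congrArg (fun t => t.2.2) ha

end main

theorem ds_iso {I I' : Type*} {M : I → Type*} {M' : I' → Type*} [∀ i, AddCommGroup (M i)]
    [∀ i, AddCommGroup (M' i)] (e : I ≃ I') (h : ∀ i, Nonempty (M (e.symm i) ≃+ M' i)) :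
    Nonempty ((⨁ i, M i) ≃+ (⨁ i, M' i)) :=
  ⟨(DirectSum.equivCongrLeft e).trans (DFinsupp.mapRange.addEquiv fun i => (h i).some)⟩

theorem fiber_equiv {I I' : Type*} (p : I → ℕ) (p' : I' → ℕ)
    (h : ∀ q, Nonempty ({i // p i = q} ↪ {i // p' i = q}))
    (h' : ∀ q, Nonempty ({i // p' i = q} ↪ {i // p i = q})) :
    ∃ e : I ≃ I', ∀ i, p (e.symm i) = p' i := by
  have := fun q => (h q).elim fun a => (h' q).elim fun b => a.antisymm b
  refine ⟨Equiv.ofFiberEquiv fun q => (this q).some, fun i => ?_⟩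
  rw [← Equiv.ofFiberEquiv_map (fun q => (this q).some), Equiv.apply_symm_apply]

theorem padic_congr (a b : ℕ) [Fact a.Prime] [Fact b.Prime] (h : a = b) :
    Nonempty (ℤ_[a] ≃+ ℤ_[b]) := by
  subst h; exact ⟨AddEquiv.refl _⟩

theorem zmod_congr (a b : ℕ) (h : a = b) : Nonempty (ZMod a ≃+ ZMod b) := by
  subst h; exact ⟨AddEquiv.refl _⟩

theorem zmod_primary {J : Type*} (n : J → ℕ) (hn : ∀ j, 0 < n j) :
    ∃ N : (Σ j, (n j).primeFactors) → ℕ, (∀ k, IsPrimePow (N k)) ∧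
      Nonempty ((⨁ j, ZMod (n j)) ≃+ ⨁ k, ZMod (N k)) := by
  classical
  refine ⟨fun k => (k.2 : ℕ) ^ (n k.1).factorization k.2, ?_, ?_⟩
  · rintro ⟨j, p, hp⟩
    have hpp := Nat.prime_of_mem_primeFactors hp
    refine hpp.isPrimePow.pow ?_
    exact (hpp.factorization_pos_of_dvd (hn j).ne' (Nat.dvd_of_mem_primeFactors hp)).ne'
  · have e1 : ∀ j, ZMod (n j) ≃+
        ⨁ p : (n j).primeFactors, ZMod ((p : ℕ) ^ (n j).factorization p) := fun j =>
      (ZMod.equivPi (n j) (hn j).ne').toAddEquiv.trans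
        (DirectSum.linearEquivFunOnFintype ℤ _ _).toAddEquiv.symm
    have e2 : (⨁ j, ZMod (n j)) ≃+ 
      ⨁ j, ⨁ p : (n j).primeFactors, ZMod ((p : ℕ) ^ (n j).factorization p) :=
      DFinsupp.mapRange.addEquiv e1
    exact ⟨e2.trans (DirectSum.sigmaCurryEquiv
      (δ := fun j (p : (n j).primeFactors) => ZMod ((p : ℕ) ^ (n j).factorization p))).symm⟩

theorem pure_conj {A B A' B' : Type*} [AddCommGroup A] [AddCommGroup B] [AddCommGroup A']
    [AddCommGroup B'] (f : A →+ B) (hf : IsPureHom f) (a : A' ≃+ A) (b : B ≃+ B') :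
    IsPureHom ((b.toAddMonoidHom.comp f).comp a.toAddMonoidHom) := by
  intro n x y hxy
  have hxy' : b (f (a x)) = n • y := hxy
  obtain ⟨z, hz⟩ := hf n (a x) (b.symm y) (by rw [← map_nsmul, ← hxy', b.symm_apply_apply])
  exact ⟨a.symm z, by rw [← map_nsmul, ← hz, a.symm_apply_apply]⟩

theorem sb_primary_s2 {I₀ I₁ J₀ J₁ : Type*}
    (p₀ : I₀ → ℕ) (p₁ : I₁ → ℕ) [∀ i, Fact (p₀ i).Prime] [∀ i, Fact (p₁ i).Prime]
    (n₀ : J₀ → ℕ) (n₁ : J₁ → ℕ) (hn₀ : ∀ j, IsPrimePow (n₀ j)) (hn₁ : ∀ j, IsPrimePow (n₁ j))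
    (D₀ D₁ : Type*) [AddCommGroup D₀] [AddCommGroup D₁]
    (hD₀ : IsDivisibleGroup D₀) (hD₁ : IsDivisibleGroup D₁)
    (f₀ : ((⨁ i, PadicInt (p₀ i)) × (⨁ j, ZMod (n₀ j)) × D₀) →+
      ((⨁ i, PadicInt (p₁ i)) × (⨁ j, ZMod (n₁ j)) × D₁)) (hf₀ : IsPureHom f₀)
    (f₁ : ((⨁ i, PadicInt (p₁ i)) × (⨁ j, ZMod (n₁ j)) × D₁) →+
      ((⨁ i, PadicInt (p₀ i)) × (⨁ j, ZMod (n₀ j)) × D₀)) (hf₁ : IsPureHom f₁) :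
    Nonempty (((⨁ i, PadicInt (p₀ i)) × (⨁ j, ZMod (n₀ j)) × D₀) ≃+
      ((⨁ i, PadicInt (p₁ i)) × (⨁ j, ZMod (n₁ j)) × D₁)) := by
  have hn₀' : ∀ j, 0 < n₀ j := fun j => (hn₀ j).pos
  have hn₁' : ∀ j, 0 < n₁ j := fun j => (hn₁ j).pos
  obtain ⟨eI, heI⟩ := fiber_equiv p₀ p₁
    (fun q => by
      by_cases hq : q.Prime
      · have : Fact q.Prime := ⟨hq⟩
        exact embI p₀ p₁ n₀ n₁ D₀ D₁ f₀ hD₁ hn₁' hf₀ q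
      · have : IsEmpty {i // p₀ i = q} := ⟨fun i => hq (i.2 ▸ Fact.out)⟩
        exact ⟨Function.Embedding.ofIsEmpty⟩)
    (fun q => by
      by_cases hq : q.Prime
      · have : Fact q.Prime := ⟨hq⟩
        exact embI p₁ p₀ n₁ n₀ D₁ D₀ f₁ hD₀ hn₀' hf₁ q
      · have : IsEmpty {i // p₁ i = q} := ⟨fun i => hq (i.2 ▸ Fact.out)⟩
        exact ⟨Function.Embedding.ofIsEmpty⟩)
  obtain ⟨eJ, heJ⟩ := fiber_equiv n₀ n₁
    (fun n => by
      by_cases hn : IsPrimePow n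
      · obtain ⟨q, k, hq, hk, rfl⟩ := (isPrimePow_nat_iff _).1 hn
        have : Fact q.Prime := ⟨hq⟩
        obtain ⟨k, rfl⟩ := Nat.exists_eq_succ_of_ne_zero hk.ne'
        exact embK p₀ p₁ n₀ n₁ D₀ D₁ f₀ hD₁ hn₁ hf₀ q k
      · have : IsEmpty {i // n₀ i = n} := ⟨fun i => hn (i.2 ▸ hn₀ _)⟩
        exact ⟨Function.Embedding.ofIsEmpty⟩)
    (fun n => by
      by_cases hn : IsPrimePow n
      · obtain ⟨q, k, hq, hk, rfl⟩ := (isPrimePow_nat_iff _).1 hn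
        have : Fact q.Prime := ⟨hq⟩
        obtain ⟨k, rfl⟩ := Nat.exists_eq_succ_of_ne_zero hk.ne'
        exact embK p₁ p₀ n₁ n₀ D₁ D₀ f₁ hD₀ hn₀ hf₁ q k
      · have : IsEmpty {i // n₁ i = n} := ⟨fun i => hn (i.2 ▸ hn₁ _)⟩
        exact ⟨Function.Embedding.ofIsEmpty⟩)
  obtain ⟨g₀, hg₀⟩ := embD p₀ p₁ n₀ n₁ D₀ D₁ f₀ hD₀ hn₁' hf₀
  obtain ⟨g₁, hg₁⟩ := embD p₁ p₀ n₁ n₀ D₁ D₀ f₁ hD₁ hn₀' hf₁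
  obtain ⟨eD⟩ := bumby hD₀ hD₁ g₀ hg₀ g₁ hg₁
  obtain ⟨a⟩ := ds_iso (M := fun i => ℤ_[p₀ i]) (M' := fun i => ℤ_[p₁ i]) eI
    (fun i => padic_congr _ _ (heI i))
  obtain ⟨b⟩ := ds_iso (M := fun i => ZMod (n₀ i)) (M' := fun i => ZMod (n₁ i)) eJ
    (fun i => zmod_congr _ _ (heJ i))
  exact ⟨a.prodCongr (b.prodCongr eD)⟩

/-- The Schröder–Bernstein property for direct sums of indecomposable
pure-injective abelian groups, with pure embeddings as arrows. -/
theorem sb_pure_injective {I₀ I₁ J₀ J₁ : Type*}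
    (p₀ : I₀ → ℕ) (p₁ : I₁ → ℕ) [∀ i, Fact (p₀ i).Prime] [∀ i, Fact (p₁ i).Prime]
    (n₀ : J₀ → ℕ) (n₁ : J₁ → ℕ) (hn₀ : ∀ j, 0 < n₀ j) (hn₁ : ∀ j, 0 < n₁ j)
    (D₀ D₁ : Type*) [AddCommGroup D₀] [AddCommGroup D₁]
    (hD₀ : IsDivisibleGroup D₀) (hD₁ : IsDivisibleGroup D₁)
    (f₀ : ((⨁ i, PadicInt (p₀ i)) × (⨁ j, ZMod (n₀ j)) × D₀) →+
      ((⨁ i, PadicInt (p₁ i)) × (⨁ j, ZMod (n₁ j)) × D₁))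
    (hf₀ : Function.Injective f₀) (hf₀pure : IsPureHom f₀)
    (f₁ : ((⨁ i, PadicInt (p₁ i)) × (⨁ j, ZMod (n₁ j)) × D₁) →+
      ((⨁ i, PadicInt (p₀ i)) × (⨁ j, ZMod (n₀ j)) × D₀))
    (hf₁ : Function.Injective f₁) (hf₁pure : IsPureHom f₁) :
    Nonempty (((⨁ i, PadicInt (p₀ i)) × (⨁ j, ZMod (n₀ j)) × D₀) ≃+
      ((⨁ i, PadicInt (p₁ i)) × (⨁ j, ZMod (n₁ j)) × D₁)) := by
  obtain ⟨N₀, hN₀, ⟨e₀⟩⟩ := zmod_primary n₀ hn₀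
  obtain ⟨N₁, hN₁, ⟨e₁⟩⟩ := zmod_primary n₁ hn₁
  let a := (AddEquiv.refl (⨁ i, PadicInt (p₀ i))).prodCongr (e₀.prodCongr (AddEquiv.refl D₀))
  let b := (AddEquiv.refl (⨁ i, PadicInt (p₁ i))).prodCongr (e₁.prodCongr (AddEquiv.refl D₁))
  obtain ⟨e⟩ := sb_primary_s2 p₀ p₁ N₀ N₁ hN₀ hN₁ D₀ D₁ hD₀ hD₁
    _ (pure_conj f₀ hf₀pure a.symm b) _ (pure_conj f₁ hf₁pure b.symm a)
  exact ⟨a.trans (e.trans b.symm)⟩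
end

section
/- For ℓ ∈ {0,1}, let K_ℓ = ⨁_{i∈I_ℓ} ℤ_{p_{ℓ,i}} be a direct sum of additive groups of p-adic integers (for primes p_{ℓ,i}), let C_ℓ = ⨁_{j∈J_ℓ} ℤ/(n_{ℓ,j}) with each n_{ℓ,j} a positive integer, let D_ℓ be a divisible abelian group, and set G_ℓ = K_ℓ × C_ℓ × D_ℓ. Let f : G₀ → G₁ be a pure injective group homomorphism. Then for every x = (k, c, d) ∈ G₀, one has k = 0 and c = 0 if and only if the K₁-component and the C₁-component of f(x) are both zero. (That is, x lies in the divisible summand D₀ if and only if f(x) lies in the divisible summand D₁.) -/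
open DirectSum

theorem divisible_part_iff {I J : Type*}
    (p : I → ℕ) [∀ i, Fact (p i).Prime] (n : J → ℕ) (hn : ∀ j, 0 < n j)
    (D : Type*) [AddCommGroup D] (hD : IsDivisibleGroup D)
    (x : (⨁ i, PadicInt (p i)) × (⨁ j, ZMod (n j)) × D) :
    (x.1 = 0 ∧ x.2.1 = 0) ↔ ∀ m : ℕ, m ≠ 0 → ∃ y, x = m • y := by
  constructor
  · rintro ⟨h1, h2⟩ m hm
    obtain ⟨y, hy⟩ := hD x.2.2 m hm
    refine ⟨(0, 0, y), ?_⟩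
    refine Prod.ext ?_ (Prod.ext ?_ ?_)
    · simp [h1]
    · simp [h2]
    · simp [hy]
  · intro h
    constructor
    · refine DFinsupp.ext fun i => ?_
      refine PadicInt.ext_of_toZModPow.1 fun k => ?_
      obtain ⟨y, hy⟩ := h (p i ^ k) (pow_ne_zero _ (Fact.out : (p i).Prime).ne_zero)
      have h1 : x.1 i = (p i ^ k) • y.1 i := by
        rw [hy]; rfl
      rw [h1, map_nsmul, DFinsupp.zero_apply, map_zero, nsmul_eq_mul, ZMod.natCast_self, zero_mul]
    · refine DFinsupp.ext fun j => ?_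
      obtain ⟨y, hy⟩ := h (n j) (hn j).ne'
      have h1 : x.2.1 j = n j • y.2.1 j := by
        rw [hy]; rfl
      rw [h1, nsmul_eq_mul, ZMod.natCast_self, zero_mul, DFinsupp.zero_apply]

/-- A pure embedding between direct sums of indecomposable pure-injective abelian
groups maps the divisible summand into the divisible summand, and only the
divisible summand there. -/
theorem pure_embedding_divisible_part {I₀ I₁ J₀ J₁ : Type*}
    (p₀ : I₀ → ℕ) (p₁ : I₁ → ℕ) [∀ i, Fact (p₀ i).Prime] [∀ i, Fact (p₁ i).Prime]
    (n₀ : J₀ → ℕ) (n₁ : J₁ → ℕ) (hn₀ : ∀ j, 0 < n₀ j) (hn₁ : ∀ j, 0 < n₁ j)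
    (D₀ D₁ : Type*) [AddCommGroup D₀] [AddCommGroup D₁]
    (hD₀ : IsDivisibleGroup D₀) (hD₁ : IsDivisibleGroup D₁)
    (f : ((⨁ i, PadicInt (p₀ i)) × (⨁ j, ZMod (n₀ j)) × D₀) →+
      ((⨁ i, PadicInt (p₁ i)) × (⨁ j, ZMod (n₁ j)) × D₁))
    (hf : Function.Injective f) (hfpure : IsPureHom f)
    (x : (⨁ i, PadicInt (p₀ i)) × (⨁ j, ZMod (n₀ j)) × D₀) :
    (x.1 = 0 ∧ x.2.1 = 0) ↔ ((f x).1 = 0 ∧ (f x).2.1 = 0) := by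
  rw [divisible_part_iff p₀ n₀ hn₀ D₀ hD₀, divisible_part_iff p₁ n₁ hn₁ D₁ hD₁]
  constructor
  · intro h m hm
    obtain ⟨y, hy⟩ := h m hm
    exact ⟨f y, by rw [hy, map_nsmul]⟩
  · intro h m hm
    obtain ⟨y, hy⟩ := h m hm
    exact hfpure m x y hy
end

section
/- For ℓ ∈ {0,1}, let K_ℓ = ⨁_{i∈I_ℓ} ℤ_{p_{ℓ,i}} be a direct sum of additive groups of p-adic integers (for primes p_{ℓ,i}), let C_ℓ = ⨁_{j∈J_ℓ} ℤ/(n_{ℓ,j}) with each n_{ℓ,j} a positive integer, let D_ℓ be a divisible abelian group, and set G_ℓ = K_ℓ × C_ℓ × D_ℓ. Let f : G₀ → G₁ be a pure injective group homomorphism. Then for every x = (k, c, d) ∈ G₀, one has k = 0 if and only if the K₁-component of f(x) is zero. (That is, x lies in the summand C₀ ⊕ D₀ if and only if f(x) lies in the summand C₁ ⊕ D₁.) -/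
open DirectSum

theorem aux_tors {J : Type*} (n : J → ℕ) (hn : ∀ j, 0 < n j) (c : ⨁ j, ZMod (n j)) :
    ∃ N : ℕ, N ≠ 0 ∧ N • c = 0 := by
  classical
  induction c using DirectSum.induction_on with
  | zero => exact ⟨1, one_ne_zero, by simp⟩
  | of j a =>
    refine ⟨n j, (hn j).ne', ?_⟩
    rw [← map_nsmul]
    simp
  | add a b ha hb =>
    obtain ⟨N, h0, h⟩ := ha
    obtain ⟨M, h0', h'⟩ := hb
    refine ⟨N * M, mul_ne_zero h0 h0', ?_⟩
    rw [nsmul_add, mul_nsmul, h, mul_nsmul', h']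
    simp

theorem aux_char {I J : Type*} (p : I → ℕ) [∀ i, Fact (p i).Prime]
    (n : J → ℕ) (hn : ∀ j, 0 < n j) (D : Type*) [AddCommGroup D] (hD : IsDivisibleGroup D)
    (x : (⨁ i, PadicInt (p i)) × (⨁ j, ZMod (n j)) × D) :
    x.1 = 0 ↔ ∃ N : ℕ, N ≠ 0 ∧ ∀ m : ℕ, m ≠ 0 → ∃ y, N • x = m • y := by
  constructor
  · intro h
    obtain ⟨N, h0, hN⟩ := aux_tors n hn x.2.1
    refine ⟨N, h0, fun m hm => ?_⟩
    obtain ⟨y, hy⟩ := hD (N • x.2.2) m hm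
    refine ⟨(0, 0, y), ?_⟩
    refine Prod.ext ?_ (Prod.ext ?_ ?_)
    · simp [h]
    · simpa using hN
    · simpa using hy.symm
  · rintro ⟨N, h0, h⟩
    refine DFinsupp.ext fun i => ?_
    have key : N • (x.1 i) = 0 := by
      refine PadicInt.ext_of_toZModPow.1 fun k => ?_
      obtain ⟨y, hy⟩ := h (p i ^ k) (pow_ne_zero _ (Fact.out : (p i).Prime).ne_zero)
      have h1 : N • (x.1 i) = (p i ^ k) • (y.1 i) := by
        have := congrArg (fun z => z.1 i) hy
        simpa only [Prod.smul_fst, DirectSum.smul_apply] using this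
      rw [h1, map_nsmul, map_zero]
      simp only [nsmul_eq_mul, ZMod.natCast_self, zero_mul]
    rw [nsmul_eq_mul] at key
    rcases mul_eq_zero.1 key with h | h
    · exact absurd (Nat.cast_eq_zero.1 h) h0
    · exact h

/-- A pure embedding between direct sums of indecomposable pure-injective abelian
groups maps the summand `C ⊕ D` (torsion plus divisible) into the corresponding
summand, and only that summand there: `x` has zero `K₀`-component iff `f x` has
zero `K₁`-component. -/
theorem pure_embedding_torsion_divisible_part {I₀ I₁ J₀ J₁ : Type*}
    (p₀ : I₀ → ℕ) (p₁ : I₁ → ℕ) [∀ i, Fact (p₀ i).Prime] [∀ i, Fact (p₁ i).Prime]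
    (n₀ : J₀ → ℕ) (n₁ : J₁ → ℕ) (hn₀ : ∀ j, 0 < n₀ j) (hn₁ : ∀ j, 0 < n₁ j)
    (D₀ D₁ : Type*) [AddCommGroup D₀] [AddCommGroup D₁]
    (hD₀ : IsDivisibleGroup D₀) (hD₁ : IsDivisibleGroup D₁)
    (f : ((⨁ i, PadicInt (p₀ i)) × (⨁ j, ZMod (n₀ j)) × D₀) →+
      ((⨁ i, PadicInt (p₁ i)) × (⨁ j, ZMod (n₁ j)) × D₁))
    (hf : Function.Injective f) (hfpure : IsPureHom f)
    (x : (⨁ i, PadicInt (p₀ i)) × (⨁ j, ZMod (n₀ j)) × D₀) :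
    x.1 = 0 ↔ (f x).1 = 0 := by
  rw [aux_char p₀ n₀ hn₀ D₀ hD₀, aux_char p₁ n₁ hn₁ D₁ hD₁]
  constructor
  · rintro ⟨N, h0, h⟩
    refine ⟨N, h0, fun m hm => ?_⟩
    obtain ⟨y, hy⟩ := h m hm
    exact ⟨f y, by rw [← map_nsmul, hy, map_nsmul]⟩
  · rintro ⟨N, h0, h⟩
    refine ⟨N, h0, fun m hm => ?_⟩
    obtain ⟨y, hy⟩ := h m hm
    exact hfpure m (N • x) y (by rw [map_nsmul, hy])
end

section
/- Let p be a prime and k a positive integer. There exist subgroups H₁ and H₂ of the additive group (ℤ_p)^k (the k-fold power of the p-adic integers) such that: each H_ℓ is a pure subgroup of (ℤ_p)^k containing all the standard basis vectors e₁, …, e_k; each H_ℓ is reduced; there exist pure injective group homomorphisms H₁ → H₂ and H₂ → H₁; and H₁ and H₂ are not isomorphic as groups. -/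
/-- A subgroup `H` of an abelian group `G` is pure if every element of `H` that is
divisible by `n` in `G` is divisible by `n` within `H`. -/
def IsPureSubgroup {G : Type*} [AddCommGroup G] (H : AddSubgroup G) : Prop :=
  ∀ (n : ℕ) (h : G), h ∈ H → (∃ g : G, h = n • g) → ∃ h' ∈ H, h = n • h'

/-- An abelian group is reduced if its only divisible subgroup is trivial. -/
def IsReducedGroup (A : Type*) [AddCommGroup A] : Prop :=
  ∀ D : AddSubgroup A, (∀ d ∈ D, ∀ n : ℕ, n ≠ 0 → ∃ y ∈ D, n • y = d) → D = ⊥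


open Polynomial in
lemma exists_trans_unit (p : ℕ) [Fact p.Prime] :
    ∃ t s : ℤ_[p], t * s = 1 ∧ Transcendental ℚ (t : ℚ_[p]) := by
  have h1 : ∃ x : ℚ_[p], Transcendental ℚ x := by
    by_contra! hc
    have hcount : Set.Countable {x : ℚ_[p] | IsAlgebraic ℚ x} := Algebraic.countable ℚ ℚ_[p]
    have hu : {x : ℚ_[p] | IsAlgebraic ℚ x} = Set.univ := by
      ext x
      have := hc x
      simpa [Transcendental] using this
    rw [hu] at hcount
    have h2 : Cardinal.mk (Set.univ : Set ℚ_[p]) ≤ Cardinal.aleph0 := hcount.le_aleph0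
    rw [Cardinal.mk_univ] at h2
    have h3 := continuum_le_cardinal_of_nontriviallyNormedField ℚ_[p]
    exact absurd (h3.trans h2) (not_le.mpr Cardinal.aleph0_lt_continuum)
  have h2 : ∃ x : ℚ_[p], ‖x‖ ≤ 1 ∧ Transcendental ℚ x := by
    obtain ⟨x, hx⟩ := h1
    by_cases h : ‖x‖ ≤ 1
    · exact ⟨x, h, hx⟩
    · refine ⟨x⁻¹, ?_, ?_⟩
      · rw [norm_inv]; exact inv_le_one_of_one_le₀ (le_of_not_ge h)
      · intro ha
        exact hx (by simpa using ha.inv)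
  obtain ⟨x, hx1, hx⟩ := h2
  let y : ℤ_[p] := ⟨x, hx1⟩
  have hn : ‖(p : ℤ_[p]) * y‖ < 1 := by
    rw [norm_mul]
    have := (PadicInt.norm_lt_one_iff_dvd (p : ℤ_[p])).mpr dvd_rfl
    have h' := PadicInt.norm_le_one y
    nlinarith [norm_nonneg (p : ℤ_[p]), norm_nonneg y]
  have hun : IsUnit (1 + (p : ℤ_[p]) * y) := by
    by_contra hc
    have h3 : ‖1 + (p : ℤ_[p]) * y‖ < 1 := PadicInt.mem_nonunits.mp hc
    have h4 : ‖(1 + (p : ℤ_[p]) * y) - (p : ℤ_[p]) * y‖ < 1 :=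
      lt_of_le_of_lt (by
        rw [sub_eq_add_neg]
        exact PadicInt.nonarchimedean _ _) (max_lt h3 (by simpa using hn))
    simp at h4
  obtain ⟨s, hs⟩ := hun.exists_right_inv
  refine ⟨_, s, hs, ?_⟩
  intro ha
  apply hx
  have hp0 : (p : ℚ_[p]) ≠ 0 := by exact_mod_cast (Fact.out : p.Prime).ne_zero
  have e : x = (p : ℚ_[p])⁻¹ * (((1 + (p : ℤ_[p]) * y : ℤ_[p]) : ℚ_[p]) - 1) := by
    push_cast
    field_simp
    simp [y, mul_comm]
  rw [e]
  exact ((isAlgebraic_natCast p).inv).mul (ha.sub isAlgebraic_one)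

def HV (p : ℕ) [Fact p.Prime] (k : ℕ) (V : Submodule ℚ ℚ_[p]) : AddSubgroup (Fin k → PadicInt p) where
  carrier := {x | ∀ i, ((x i : ℤ_[p]) : ℚ_[p]) ∈ V}
  add_mem' := by
    intro a b ha hb i
    simpa using V.add_mem (ha i) (hb i)
  zero_mem' := by intro i; simp
  neg_mem' := by
    intro a ha i
    simpa using ha i

lemma HV_mem {p : ℕ} [Fact p.Prime] {k : ℕ} {V : Submodule ℚ ℚ_[p]} {x : Fin k → PadicInt p} :
    x ∈ HV p k V ↔ ∀ i, ((x i : ℤ_[p]) : ℚ_[p]) ∈ V := Iff.rfl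

lemma HV_div {p : ℕ} [Fact p.Prime] {k : ℕ} {V : Submodule ℚ ℚ_[p]} {g : Fin k → PadicInt p}
    {n : ℕ} (hn : n ≠ 0) (h : n • g ∈ HV p k V) : g ∈ HV p k V := by
  intro i
  have h1 := V.smul_mem ((n : ℚ)⁻¹) (h i)
  have h2 : ((n : ℚ)⁻¹) • (((n • g) i : ℤ_[p]) : ℚ_[p]) = ((g i : ℤ_[p]) : ℚ_[p]) := by
    have : (n : ℚ_[p]) ≠ 0 := by exact_mod_cast hn
    rw [Algebra.smul_def]
    simp
    field_simp
  rwa [h2] at h1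

lemma HV_pure (p : ℕ) [Fact p.Prime] (k : ℕ) (V : Submodule ℚ ℚ_[p]) :
    IsPureSubgroup (HV p k V) := by
  rintro n h hh ⟨g, rfl⟩
  rcases eq_or_ne n 0 with rfl | hn
  · exact ⟨0, zero_mem _, by simp⟩
  · exact ⟨g, HV_div hn hh, rfl⟩

lemma eq_zero_of_div {p : ℕ} [Fact p.Prime] {k : ℕ} (x : Fin k → PadicInt p)
    (h : ∀ n : ℕ, ∃ y : Fin k → PadicInt p, x = (p ^ n) • y) : x = 0 := by
  ext1 i
  by_contra hx
  have h0 : (0 : ℝ) < ‖x i‖ := norm_pos_iff.mpr hx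
  obtain ⟨n, hn⟩ := PadicInt.exists_pow_neg_lt p h0
  obtain ⟨y, hy⟩ := h n
  have : ‖x i‖ ≤ (p : ℝ) ^ (-(n : ℤ)) := by
    rw [PadicInt.norm_le_pow_iff_mem_span_pow, Ideal.mem_span_singleton, hy]
    exact ⟨y i, by simp⟩
  linarith

lemma HV_reduced (p : ℕ) [Fact p.Prime] (k : ℕ) (V : Submodule ℚ ℚ_[p]) :
    IsReducedGroup (HV p k V) := by
  intro D hD
  rw [eq_bot_iff]
  intro d hd
  rw [AddSubgroup.mem_bot]
  apply Subtype.ext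
  apply eq_zero_of_div
  intro n
  obtain ⟨y, -, hy⟩ := hD d hd (p ^ n) (pow_ne_zero _ (Fact.out : p.Prime).ne_zero)
  exact ⟨y, by rw [← hy]; simp⟩

lemma hom_smul {p : ℕ} [Fact p.Prime] {k : ℕ} {V W : Submodule ℚ ℚ_[p]}
    (φ : HV p k V →+ HV p k W) (t : ℤ_[p]) (h : HV p k V) (h' : HV p k V)
    (e : (h' : Fin k → ℤ_[p]) = t • (h : Fin k → ℤ_[p])) :
    (φ h' : Fin k → ℤ_[p]) = t • (φ h : Fin k → ℤ_[p]) := by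
  rw [← sub_eq_zero]
  apply eq_zero_of_div
  intro n
  have h1 := PadicInt.appr_spec n t
  rw [Ideal.mem_span_singleton] at h1
  obtain ⟨s, hs⟩ := h1
  have ht : t = (t.appr n : ℤ_[p]) + (p : ℤ_[p]) ^ n * s := by rw [← hs]; ring
  generalize t.appr n = a at ht
  have e1 : ((h' - a • h : HV p k V) : Fin k → ℤ_[p]) = (p ^ n) • (s • (h : Fin k → ℤ_[p])) := by
    ext1 i
    simp [e]
    rw [ht]; ring
  have hm : s • (h : Fin k → ℤ_[p]) ∈ HV p k V := by
    apply HV_div (pow_ne_zero n (Fact.out : p.Prime).ne_zero)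
    rw [← e1]; exact Subtype.mem _
  have e2 : h' = a • h + (p ^ n) • (⟨_, hm⟩ : HV p k V) := by
    rw [← sub_eq_iff_eq_add']
    apply Subtype.ext
    rw [e1]; simp
  refine ⟨(φ ⟨_, hm⟩ : Fin k → ℤ_[p]) - s • (φ h : Fin k → ℤ_[p]), ?_⟩
  rw [e2, map_add, map_nsmul, map_nsmul]
  ext1 i
  simp
  rw [ht]; ring

theorem padic_power_not_SB (p : ℕ) [Fact p.Prime] (k : ℕ) (hk : 0 < k) :
    ∃ H₁ H₂ : AddSubgroup (Fin k → PadicInt p),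
      IsPureSubgroup H₁ ∧ IsPureSubgroup H₂ ∧
      (∀ i : Fin k, Pi.single i (1 : PadicInt p) ∈ H₁) ∧
      (∀ i : Fin k, Pi.single i (1 : PadicInt p) ∈ H₂) ∧
      IsReducedGroup H₁ ∧ IsReducedGroup H₂ ∧
      (∃ f : H₁ →+ H₂, Function.Injective f ∧ IsPureHom f) ∧
      (∃ g : H₂ →+ H₁, Function.Injective g ∧ IsPureHom g) ∧
      ¬ Nonempty (H₁ ≃+ H₂) := by
  obtain ⟨t, s, hts, ht⟩ := exists_trans_unit p
  let ev : Polynomial ℚ →ₗ[ℚ] ℚ_[p] := (Polynomial.aeval (t : ℚ_[p])).toLinearMap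
  have hev : ∀ q, ev q = Polynomial.aeval (t : ℚ_[p]) q := fun q => rfl
  let V : Submodule ℚ ℚ_[p] := LinearMap.range ev
  let W : Submodule ℚ ℚ_[p] := (LinearMap.ker (Polynomial.lcoeff ℚ 1)).map ev
  have hWV : W ≤ V := LinearMap.map_le_range
  have h1W : (1 : ℚ_[p]) ∈ W := ⟨1, by simp [Polynomial.coeff_one], by simp [hev]⟩
  have hsing : ∀ (U : Submodule ℚ ℚ_[p]), (1 : ℚ_[p]) ∈ U →
      ∀ i : Fin k, Pi.single i (1 : PadicInt p) ∈ HV p k U := by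
    intro U hU i j
    rcases eq_or_ne j i with rfl | hij
    · simpa using hU
    · simp [hij]
  have hVt : ∀ x ∈ V, (t : ℚ_[p]) * x ∈ V := by
    rintro _ ⟨q, rfl⟩
    exact ⟨Polynomial.X * q, by simp [hev]⟩
  have hVW : ∀ x ∈ V, (t : ℚ_[p]) * (t * x) ∈ W := by
    rintro _ ⟨q, rfl⟩
    exact ⟨Polynomial.X * (Polynomial.X * q), by simp [Polynomial.coeff_X_mul], by simp [hev]⟩
  have htW : (t : ℚ_[p]) ∉ W := by
    rintro ⟨q, hq, hq2⟩
    have h3 : Polynomial.aeval (t : ℚ_[p]) q = Polynomial.aeval (t : ℚ_[p]) (Polynomial.X : Polynomial ℚ) := by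
      rw [← hev, hq2]; simp
    have h4 := (transcendental_iff_injective.mp ht) h3
    subst h4
    simp at hq
  refine ⟨HV p k V, HV p k W, HV_pure p k _, HV_pure p k _, hsing _ (hWV h1W), hsing _ h1W,
    HV_reduced p k _, HV_reduced p k _, ?_, ?_, ?_⟩
  · let f : HV p k V →+ HV p k W :=
      { toFun := fun x => ⟨t • (t • (x : Fin k → ℤ_[p])), fun i => by
          simpa using hVW _ (x.2 i)⟩
        map_zero' := by apply Subtype.ext; simp
        map_add' := by intro x y; apply Subtype.ext; simp }
    have hf : ∀ x, s • s • (f x : Fin k → ℤ_[p]) = x := by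
      intro x
      change s • s • t • t • (x : Fin k → ℤ_[p]) = x
      simp only [smul_smul]
      have : s * (s * (t * t)) = 1 := by linear_combination (t * s + 1) * hts
      rw [this, one_smul]
    refine ⟨f, ?_, ?_⟩
    · intro x y hxy
      apply Subtype.ext
      rw [← hf x, ← hf y, hxy]
    · intro n a b hab
      obtain ⟨a', ha', e⟩ := HV_pure p k V n a a.2 ⟨s • s • (b : Fin k → ℤ_[p]), by
        rw [← hf a, hab]
        ext1 i
        simp
        ring⟩
      exact ⟨⟨a', ha'⟩, Subtype.ext (by simpa using e)⟩
  · refine ⟨AddSubgroup.inclusion (fun x hx i => hWV (hx i)),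
      AddSubgroup.inclusion_injective _, ?_⟩
    intro n a b hab
    obtain ⟨a', ha', e⟩ := HV_pure p k W n a a.2 ⟨b, by
      exact congrArg Subtype.val hab⟩
    exact ⟨⟨a', ha'⟩, Subtype.ext (by simpa using e)⟩
  · rintro ⟨φ⟩
    let i0 : Fin k := ⟨0, hk⟩
    let e1 : HV p k W := ⟨_, hsing _ h1W i0⟩
    let h := φ.symm e1
    have key := hom_smul φ.toAddMonoidHom t h ⟨t • (h : Fin k → ℤ_[p]), fun i => by
      simpa using hVt _ (h.2 i)⟩ rfl
    have hh : φ.toAddMonoidHom h = e1 := φ.apply_symm_apply e1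
    rw [hh] at key
    have hmem := (φ.toAddMonoidHom ⟨t • (h : Fin k → ℤ_[p]), fun i => by
      simpa using hVt _ (h.2 i)⟩).2 i0
    rw [key] at hmem
    apply htW
    simpa [e1] using hmem
end

section
/- Let I be an index type and ⟨p_i : i ∈ I⟩ pairwise distinct primes. For each i ∈ I let H_i and K_i be abelian groups such that: (a) for all i and all j ≠ i, every element of H_i is divisible by p_j^n for every natural number n; and (b) for each j, the only element of K_j that is divisible by p_j^n for every natural number n is 0. Then every group homomorphism φ : ⨁_{i∈I} H_i → ⨁_{i∈I} K_i maps the canonical image of each H_i into the canonical image of K_i. -/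
open DirectSum

/-- If each `H i` is divisible by all powers of the primes `p j` for `j ≠ i`, and in
each `K j` only `0` is divisible by all powers of `p j`, then any homomorphism of the
direct sums maps the canonical image of `H i` into the canonical image of `K i`. -/
theorem hom_of_direct_sums_preserves_components {I : Type*} [DecidableEq I]
    (p : I → ℕ) (hp : ∀ i, (p i).Prime) (hinj : Function.Injective p)
    (H K : I → Type*) [∀ i, AddCommGroup (H i)] [∀ i, AddCommGroup (K i)]
    (ha : ∀ i j, j ≠ i → ∀ h : H i, ∀ n : ℕ, ∃ b : H i, (p j) ^ n • b = h)
    (hb : ∀ j (x : K j), (∀ n : ℕ, ∃ b : K j, (p j) ^ n • b = x) → x = 0)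
    (φ : (⨁ i, H i) →+ ⨁ i, K i) (i : I) (h : H i) :
    ∃ x : K i, φ (DirectSum.of H i h) = DirectSum.of K i x := by
  refine ⟨φ (DirectSum.of H i h) i, ?_⟩
  refine DFinsupp.ext fun j => ?_
  by_cases hj : j = i
  · subst hj
    exact (DirectSum.of_eq_same j _).symm
  · have h0 : (DirectSum.of K i (φ (DirectSum.of H i h) i)) j = 0 :=
      DirectSum.of_eq_of_ne _ _ _ hj
    refine Eq.trans ?_ h0.symm
    apply hb j
    intro n
    obtain ⟨b, rfl⟩ := ha i j hj h n
    refine ⟨φ (DirectSum.of H i b) j, ?_⟩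
    rw [map_nsmul, map_nsmul]
    rfl
end

section
/- Let C be a direct sum of finite cyclic groups (C = ⨁_{j∈J} ℤ/(n j) with each n j a positive integer), let D be a divisible abelian group, and let K₁, K₂ be reduced torsion-free abelian groups such that there exist pure injective group homomorphisms K₁ → K₂ and K₂ → K₁ but K₁ and K₂ are not isomorphic. Then the groups G₁ = K₁ × C × D and G₂ = K₂ × C × D admit pure injective group homomorphisms G₁ → G₂ and G₂ → G₁ but are not isomorphic as groups. -/
open DirectSum

/-- An abelian group is torsion-free if `n • x = 0` for `0 < n` implies `x = 0`. -/
def IsTorsionFreeGroup (A : Type*) [AddCommGroup A] : Prop :=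
  ∀ (x : A) (n : ℕ), 0 < n → n • x = 0 → x = 0

theorem aux_hom_zero {J : Type*} (n : J → ℕ) (hn : ∀ j, 0 < n j)
    (D : Type*) [AddCommGroup D] (hD : IsDivisibleGroup D)
    (K : Type*) [AddCommGroup K] (hr : IsReducedGroup K) (ht : IsTorsionFreeGroup K)
    (h : ((⨁ j, ZMod (n j)) × D) →+ K) (x : (⨁ j, ZMod (n j)) × D) : h x = 0 := by
  classical
  have h1 : h.comp (AddMonoidHom.inl _ D) = 0 := by
    apply DirectSum.addHom_ext
    intro j y
    apply ht _ (n j) (hn j)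
    rw [← map_nsmul, ← map_nsmul]
    have : n j • y = 0 := by simp
    rw [this, map_zero, map_zero]
  have h2 : (h.comp (AddMonoidHom.inr (⨁ j, ZMod (n j)) D)).range = ⊥ := by
    apply hr
    rintro _ ⟨d, rfl⟩ m hm
    obtain ⟨y, rfl⟩ := hD d m hm
    exact ⟨_, ⟨y, rfl⟩, (map_nsmul _ _ _).symm⟩
  obtain ⟨c, d⟩ := x
  have e1 : h (c, 0) = 0 := DFunLike.congr_fun h1 c
  have e2 : h (0, d) = 0 := by
    have : h (0, d) ∈ (h.comp (AddMonoidHom.inr (⨁ j, ZMod (n j)) D)).range := ⟨d, rfl⟩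
    rw [h2] at this
    simpa using this
  have : ((c, d) : (⨁ j, ZMod (n j)) × D) = (c, 0) + (0, d) := by simp
  rw [this, map_add, e1, e2, add_zero]

theorem aux_pure {A B C : Type*} [AddCommGroup A] [AddCommGroup B] [AddCommGroup C]
    (h : ∃ f : A →+ B, Function.Injective f ∧ IsPureHom f) :
    ∃ f : (A × C) →+ (B × C), Function.Injective f ∧ IsPureHom f := by
  obtain ⟨f, hf, hp⟩ := h
  refine ⟨f.prodMap (AddMonoidHom.id C), ?_, ?_⟩
  · exact hf.prodMap Function.injective_id
  · rintro m ⟨a, c⟩ ⟨b, c'⟩ h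
    have h1 : f a = m • b := congrArg Prod.fst h
    have h2 : c = m • c' := congrArg Prod.snd h
    obtain ⟨a', rfl⟩ := hp m a b h1
    exact ⟨(a', c'), by rw [h2]; rfl⟩

theorem aux_inv {A B C : Type*} [AddCommGroup A] [AddCommGroup B] [AddCommGroup C]
    (hA : ∀ (h : C →+ A) (x : C), h x = 0)
    (e : (A × C) ≃+ (B × C)) (k : A) :
    (e.symm ((e (k, 0)).1, 0)).1 = k := by
  have h0 := hA ((AddMonoidHom.fst A C).comp (e.symm.toAddMonoidHom.comp (AddMonoidHom.inr B C)))
    (e (k, 0)).2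
  have h0' : (e.symm (0, (e (k, 0)).2)).1 = 0 := h0
  have h1 : e (k, 0) = ((e (k, 0)).1, 0) + (0, (e (k, 0)).2) := by simp
  have h2 : e.symm (e (k, 0)) = e.symm ((e (k, 0)).1, 0) + e.symm (0, (e (k, 0)).2) := by
    rw [← map_add, ← h1]
  have h3 := congrArg Prod.fst h2
  rw [Prod.fst_add, h0', add_zero, e.symm_apply_apply] at h3
  exact h3.symm

/-- A failure of Schröder–Bernstein for reduced torsion-free groups `K₁, K₂`
propagates to the groups `Kₗ × C × D` with `C` a direct sum of finite cyclic
groups and `D` divisible. -/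
theorem not_SB_of_summand_not_SB {J : Type*} (n : J → ℕ) (hn : ∀ j, 0 < n j)
    (D : Type*) [AddCommGroup D] (hD : IsDivisibleGroup D)
    (K₁ K₂ : Type*) [AddCommGroup K₁] [AddCommGroup K₂]
    (hK₁red : IsReducedGroup K₁) (hK₂red : IsReducedGroup K₂)
    (hK₁tf : IsTorsionFreeGroup K₁) (hK₂tf : IsTorsionFreeGroup K₂)
    (hK12 : ∃ f : K₁ →+ K₂, Function.Injective f ∧ IsPureHom f)
    (hK21 : ∃ g : K₂ →+ K₁, Function.Injective g ∧ IsPureHom g)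
    (hKnoniso : ¬ Nonempty (K₁ ≃+ K₂)) :
    (∃ f : (K₁ × (⨁ j, ZMod (n j)) × D) →+ (K₂ × (⨁ j, ZMod (n j)) × D),
        Function.Injective f ∧ IsPureHom f) ∧
    (∃ g : (K₂ × (⨁ j, ZMod (n j)) × D) →+ (K₁ × (⨁ j, ZMod (n j)) × D),
        Function.Injective g ∧ IsPureHom g) ∧
    ¬ Nonempty ((K₁ × (⨁ j, ZMod (n j)) × D) ≃+ (K₂ × (⨁ j, ZMod (n j)) × D)) := by
  refine ⟨aux_pure hK12, aux_pure hK21, ?_⟩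
  rintro ⟨e⟩
  have z1 := aux_hom_zero n hn D hD K₁ hK₁red hK₁tf
  have z2 := aux_hom_zero n hn D hD K₂ hK₂red hK₂tf
  apply hKnoniso
  refine ⟨{ toFun := fun k => (e (k, 0)).1, invFun := fun k => (e.symm (k, 0)).1,
            left_inv := aux_inv z1 e, right_inv := aux_inv z2 e.symm, map_add' := ?_ }⟩
  intro x y
  exact map_add ((AddMonoidHom.fst K₂ _).comp (e.toAddMonoidHom.comp (AddMonoidHom.inl K₁ _))) x y
end

section
/- Let S be an infinite set of prime numbers and let ⟨r_p : p ∈ S⟩ be a family of positive integers. Set G = ⨁_{p∈S} (ℤ/p)^{r_p} and Ĝ = ∏_{p∈S} (ℤ/p)^{r_p}. Then there exist subgroups H₁ and H₂ of Ĝ, each containing G (identified with its canonical image in Ĝ), each a pure subgroup of Ĝ, and each reduced, such that there exist pure injective group homomorphisms H₁ → H₂ and H₂ → H₁, but H₁ and H₂ are not isomorphic as groups. In particular, the theory of G does not have the Schröder–Bernstein property, witnessed by a pair of reduced groups. -/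
/-- The canonical copy of the direct sum `⨁_{p ∈ S} (ℤ/p)^{r_p}` inside the product
`∏_{p ∈ S} (ℤ/p)^{r_p}`: the subgroup of finitely supported elements. -/
def directSumInProduct (S : Set ℕ) (r : S → ℕ) :
    AddSubgroup (∀ p : S, Fin (r p) → ZMod p) where
  carrier := {x : ∀ p : S, Fin (r p) → ZMod p | {p : S | x p ≠ 0}.Finite}
  zero_mem' := by
    simp
  add_mem' := by
    intro a b ha hb
    refine Set.Finite.subset (ha.union hb) ?_
    intro p hp
    by_contra hcon
    simp only [Set.mem_union, Set.mem_setOf_eq, not_or, not_not] at hcon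
    exact hp (by simp [hcon.1, hcon.2])
  neg_mem' := by
    intro a ha
    simpa using ha

open Filter Polynomial in
theorem ubs_littleO (P : ℤ[X]) :
    (fun n : ℕ => ((P.eval (n : ℤ) : ℤ) : ℝ)) =o[atTop] (fun n : ℕ => (2 : ℝ) ^ n) := by
  induction P using Polynomial.induction_on' with
  | add p q hp hq => simpa using hp.add hq
  | monomial k a =>
    have := (isLittleO_pow_const_const_pow_of_one_lt (R := ℝ) k (one_lt_two)).const_mul_left (a : ℝ)
    simpa using this

open Filter Polynomial in
theorem ubs_zero (S : Set ℕ) (hS : S.Infinite) (P : ℤ[X])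
    (h : ∀ᶠ p : S in cofinite, ((P.eval (Nat.log 2 p : ℤ) : ℤ) : ZMod p) = 0) : P = 0 := by
  by_contra hP
  have : Infinite S := hS.to_subtype
  have hval : Tendsto (fun p : S => (p : ℕ)) cofinite atTop := by
    rw [← Nat.cofinite_eq_atTop]
    exact Subtype.val_injective.tendsto_cofinite
  have hlog : Tendsto (fun p : S => Nat.log 2 (p : ℕ)) cofinite atTop := by
    refine Tendsto.comp (g := Nat.log 2) ?_ hval
    refine tendsto_atTop_mono' _ (f₁ := Nat.log 2) (.of_forall fun _ => le_rfl) ?_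
    refine tendsto_atTop_atTop.2 fun b => ⟨2 ^ b, fun a ha => ?_⟩
    exact Nat.le_log_of_pow_le (by norm_num) ha
  have h1 : ∀ᶠ m : ℕ in atTop, P.eval (m : ℤ) ≠ 0 := by
    rw [← Nat.cofinite_eq_atTop]
    have : Tendsto (fun m : ℕ => (m : ℤ)) cofinite cofinite :=
      (Nat.cast_injective).tendsto_cofinite
    refine this.eventually (p := fun z => P.eval z ≠ 0) ?_
    rw [eventually_cofinite]
    refine (Polynomial.finite_setOfPred_isRoot hP).subset ?_
    intro z hz
    simpa using hz
  have h2 : ∀ᶠ m : ℕ in atTop, |P.eval (m : ℤ)| < 2 ^ m := by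
    have := (ubs_littleO P).def (c := 1 / 2) (by norm_num)
    filter_upwards [this] with m hm
    have h3 : |((P.eval (m : ℤ) : ℤ) : ℝ)| < 2 ^ m := by
      rw [Real.norm_eq_abs, Real.norm_eq_abs, abs_of_pos (a := (2 : ℝ) ^ m) (by positivity)] at hm
      have : (0 : ℝ) < 2 ^ m := by positivity
      linarith
    exact_mod_cast h3
  obtain ⟨p, hp0, hp1, hp2, hp3⟩ := (h.and ((hlog.eventually h1).and ((hlog.eventually h2).and
    (hval.eventually (eventually_ge_atTop 1))))).exists
  rw [ZMod.intCast_zmod_eq_zero_iff_dvd] at hp0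
  refine hp1 (Int.eq_zero_of_abs_lt_dvd hp0 (lt_of_lt_of_le hp2 ?_))
  exact_mod_cast Nat.pow_log_le_self 2 (by omega)

open Filter Polynomial in
/-- The subgroup attached to an additive group of polynomials. -/
def ubsH (S : Set ℕ) (r : S → ℕ) (M : AddSubgroup ℤ[X]) :
    AddSubgroup (∀ p : S, Fin (r p) → ZMod p) where
  carrier := {x | ∃ n : ℤ, n ≠ 0 ∧ ∃ P ∈ M, ∀ᶠ p : S in cofinite, ∀ i,
    (n : ZMod p) * x p i = ((P.eval (Nat.log 2 p : ℤ) : ℤ) : ZMod p)}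
  zero_mem' := ⟨1, one_ne_zero, 0, M.zero_mem, .of_forall fun p i => by simp⟩
  add_mem' := by
    rintro a b ⟨n, hn, P, hP, h⟩ ⟨m, hm, Q, hQ, h'⟩
    refine ⟨n * m, mul_ne_zero hn hm, m • P + n • Q,
      M.add_mem (M.zsmul_mem hP _) (M.zsmul_mem hQ _), ?_⟩
    filter_upwards [h, h'] with p hp hp' i
    simp only [Pi.add_apply, Polynomial.eval_add, Polynomial.eval_smul, smul_eq_mul,
      Int.cast_add, Int.cast_mul, ← hp i, ← hp' i]
    ring
  neg_mem' := by
    rintro a ⟨n, hn, P, hP, h⟩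
    refine ⟨n, hn, -P, M.neg_mem hP, ?_⟩
    filter_upwards [h] with p hp i
    simp [← hp i]

open Filter Polynomial in
theorem ubs_div (S : Set ℕ) (r : S → ℕ) (M : AddSubgroup ℤ[X]) (n : ℕ) (hn : n ≠ 0)
    (g : ∀ p : S, Fin (r p) → ZMod p) (h : n • g ∈ ubsH S r M) : g ∈ ubsH S r M := by
  obtain ⟨m, hm, P, hP, h⟩ := h
  refine ⟨m * n, mul_ne_zero hm (by exact_mod_cast hn), P, hP, ?_⟩
  filter_upwards [h] with p hp i
  rw [← hp i]
  simp [mul_assoc]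

theorem ubs_pure (S : Set ℕ) (r : S → ℕ) (M : AddSubgroup (Polynomial ℤ)) :
    IsPureSubgroup (ubsH S r M) := by
  rintro n h hh ⟨g, rfl⟩
  by_cases hn : n = 0
  · exact ⟨0, zero_mem _, by simp [hn]⟩
  · exact ⟨g, ubs_div S r M n hn g hh, rfl⟩

open Filter in
theorem ubs_le (S : Set ℕ) (r : S → ℕ) (M : AddSubgroup (Polynomial ℤ)) :
    directSumInProduct S r ≤ ubsH S r M := by
  intro x hx
  refine ⟨1, one_ne_zero, 0, M.zero_mem, ?_⟩
  have : ∀ᶠ p : S in cofinite, x p = 0 := hx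
  filter_upwards [this] with p hp i
  simp [hp]

theorem ubs_red (S : Set ℕ) (hprime : ∀ p ∈ S, p.Prime) (r : S → ℕ)
    (H : AddSubgroup (∀ p : S, Fin (r p) → ZMod p)) : IsReducedGroup H := by
  intro D hD
  rw [eq_bot_iff]
  intro d hd
  rw [AddSubgroup.mem_bot]
  ext p i
  obtain ⟨y, -, rfl⟩ := hD d hd p (hprime p p.2).ne_zero
  simp

/-- If `x p = 0` then `f x p = 0`. -/
theorem ubs_local (S : Set ℕ) (hprime : ∀ p ∈ S, p.Prime) (r : S → ℕ)
    (M : AddSubgroup (Polynomial ℤ))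
    (H : AddSubgroup (∀ p : S, Fin (r p) → ZMod p)) (f : ubsH S r M →+ H)
    (x : ubsH S r M) (p : S) (hx : x.1 p = 0) : (f x).1 p = 0 := by
  have key : ∃ y : ∀ p : S, Fin (r p) → ZMod p, x.1 = (p : ℕ) • y := by
    refine ⟨fun q i => ((p : ℕ) : ZMod q)⁻¹ * x.1 q i, ?_⟩
    ext q i
    by_cases hq : q = p
    · subst hq
      simp [hx]
    · have := Fact.mk (hprime q q.2)
      have hne : ((p : ℕ) : ZMod q) ≠ 0 := by
        rw [Ne, ZMod.natCast_eq_zero_iff, Nat.prime_dvd_prime_iff_eq (hprime q q.2) (hprime p p.2)]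
        exact fun h => hq (Subtype.ext h)
      simp [mul_inv_cancel_left₀ hne]
  obtain ⟨y, hy⟩ := key
  have hyM : y ∈ ubsH S r M := ubs_div S r M p (hprime p p.2).ne_zero y (hy ▸ x.2)
  have : x = (p : ℕ) • (⟨y, hyM⟩ : ubsH S r M) := Subtype.ext hy
  rw [this, map_nsmul]
  ext i
  simp

theorem ubs_scal (S : Set ℕ) (hprime : ∀ p ∈ S, p.Prime) (r : S → ℕ)
    (M : AddSubgroup (Polynomial ℤ))
    (H : AddSubgroup (∀ p : S, Fin (r p) → ZMod p)) (f : ubsH S r M →+ H)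
    (x v : ubsH S r M) (p : S) (m k : ℤ) (hx : ∀ i, (m : ZMod p) * x.1 p i = k * v.1 p i) (i) :
    (m : ZMod p) * (f x).1 p i = k * (f v).1 p i := by
  have := ubs_local S hprime r M H f (m • x - k • v) p (by
    ext i
    simp [hx i])
  have := congrFun this i
  rw [map_sub, map_zsmul, map_zsmul] at this
  simpa [sub_eq_zero] using this

/-- Polynomials with vanishing linear coefficient. -/
def ubsM : AddSubgroup (Polynomial ℤ) where
  carrier := {P | P.coeff 1 = 0}
  zero_mem' := by simp
  add_mem' := by
    intro a b ha hb
    simp_all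
  neg_mem' := by
    intro a ha
    simp_all

open Filter Polynomial in
theorem ubs_noniso (S : Set ℕ) (hS : S.Infinite) (hprime : ∀ p ∈ S, p.Prime)
    (r : S → ℕ) (hr : ∀ p, 0 < r p) (C : ubsH S r ⊤ ≃+ ubsH S r ubsM) : False := by
  have hv : ∀ M : AddSubgroup ℤ[X], 1 ∈ M →
      (fun p i => 1 : ∀ p : S, Fin (r p) → ZMod p) ∈ ubsH S r M := fun M h1 =>
    ⟨1, one_ne_zero, 1, h1, .of_forall fun p i => by simp⟩
  have h1M : (1 : ℤ[X]) ∈ ubsM := by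
    change coeff 1 1 = 0
    simp [coeff_one]
  let v : ubsH S r ⊤ := ⟨_, hv ⊤ trivial⟩
  let v' : ubsH S r ubsM := ⟨_, hv ubsM h1M⟩
  let tv : ubsH S r ⊤ := ⟨fun p i => ((Nat.log 2 p : ℤ) : ZMod p),
    1, one_ne_zero, X, trivial, .of_forall fun p i => by simp⟩
  obtain ⟨n, hn, P, hP, hw⟩ := (C v).2
  obtain ⟨u, hu⟩ := C.surjective v'
  obtain ⟨m, hm, Q, -, hQ⟩ := u.2
  obtain ⟨k, hk, R, hR, hRe⟩ := (C tv).2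
  have e1 : Q * P - Polynomial.C (n * m) = 0 := by
    apply ubs_zero S hS
    filter_upwards [hw, hQ] with p hw hQ
    have h := ubs_scal S hprime r ⊤ _ C.toAddMonoidHom u v p m (Q.eval (Nat.log 2 p : ℤ))
      (fun i => by rw [hQ i]; simp [v]) ⟨0, hr p⟩
    have hw := hw ⟨0, hr p⟩
    have h' : (m : ZMod p) = (Q.eval (Nat.log 2 p : ℤ) : ℤ) * (C v).1 p ⟨0, hr p⟩ := by
      have : (C.toAddMonoidHom u) = v' := hu
      rw [this] at h
      simpa [v'] using h
    simp only [eval_sub, eval_mul, eval_C, Int.cast_sub, Int.cast_mul, ← hw]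
    rw [h']
    ring
  have e2 : Polynomial.C k * (P * X) - Polynomial.C n * R = 0 := by
    apply ubs_zero S hS
    filter_upwards [hw, hRe] with p hw hRe
    have h := ubs_scal S hprime r ⊤ _ C.toAddMonoidHom tv v p 1 (Nat.log 2 p : ℤ)
      (fun i => by simp [v, tv]) ⟨0, hr p⟩
    have hw := hw ⟨0, hr p⟩
    have hRe := hRe ⟨0, hr p⟩
    have h' : (C tv).1 p ⟨0, hr p⟩ = ((Nat.log 2 p : ℤ) : ZMod p) * (C v).1 p ⟨0, hr p⟩ := by
      simpa using h
    simp only [eval_sub, eval_mul, eval_C, eval_X, Int.cast_sub, Int.cast_mul, ← hw, ← hRe, h']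
    ring
  have e3 := congrArg (fun Z => coeff Z 1) e2
  have hR' : R.coeff 1 = 0 := hR
  simp [hR', hk] at e3
  have hnm : Polynomial.C (n * m) ≠ 0 := by simpa using ⟨hn, hm⟩
  rw [sub_eq_zero] at e1
  have hQ0 : Q ≠ 0 := by
    rintro rfl
    exact hnm (by simpa using e1.symm)
  have hP0 : P ≠ 0 := by
    rintro rfl
    exact hnm (by simpa using e1.symm)
  have hd := congrArg natDegree e1
  rw [natDegree_mul hQ0 hP0, natDegree_C] at hd
  have hPd : P.natDegree = 0 := by omega
  rw [eq_C_of_natDegree_eq_zero hPd, e3] at hP0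
  simp at hP0

/-- The theory of `⨁_{p ∈ S} (ℤ/p)^{r_p}` (for `S` an infinite set of primes) fails
the Schröder–Bernstein property, witnessed by a pair of reduced pure subgroups of
`∏_{p ∈ S} (ℤ/p)^{r_p}` containing the direct sum. -/
theorem unbounded_socle_not_SB (S : Set ℕ) (hS : S.Infinite) (hprime : ∀ p ∈ S, p.Prime)
    (r : S → ℕ) (hr : ∀ p, 0 < r p) :
    ∃ H₁ H₂ : AddSubgroup (∀ p : S, Fin (r p) → ZMod p),
      directSumInProduct S r ≤ H₁ ∧ directSumInProduct S r ≤ H₂ ∧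
      IsPureSubgroup H₁ ∧ IsPureSubgroup H₂ ∧
      IsReducedGroup H₁ ∧ IsReducedGroup H₂ ∧
      (∃ f : H₁ →+ H₂, Function.Injective f ∧ IsPureHom f) ∧
      (∃ g : H₂ →+ H₁, Function.Injective g ∧ IsPureHom g) ∧
      ¬ Nonempty (H₁ ≃+ H₂) := by
  have hT : ∀ p : S, ((Nat.log 2 p : ℕ) : ZMod p) ≠ 0 := by
    intro p
    have hp := hprime p p.2
    rw [Ne, ZMod.natCast_eq_zero_iff]
    intro hd
    have h1 : 0 < Nat.log 2 p := Nat.log_pos (by norm_num) hp.two_le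
    exact absurd (Nat.le_of_dvd h1 hd) (not_le.2 (Nat.log_lt_self 2 hp.ne_zero))
  have hfd : ∀ x ∈ ubsH S r ⊤,
      (fun p i => ((Nat.log 2 p : ℕ) : ZMod p) ^ 2 * x p i :
        ∀ p : S, Fin (r p) → ZMod p) ∈ ubsH S r ubsM := by
    rintro x ⟨n, hn, P, -, h⟩
    refine ⟨n, hn, P * Polynomial.X ^ 2, ?_, ?_⟩
    · change (P * Polynomial.X ^ 2).coeff 1 = 0
      rw [Polynomial.coeff_mul_X_pow']
      simp
    · filter_upwards [h] with p hp i
      simp only [Polynomial.eval_mul, Polynomial.eval_pow, Polynomial.eval_X, Int.cast_mul, ← hp i]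
      push_cast
      ring
  let f : ubsH S r ⊤ →+ ubsH S r ubsM :=
    { toFun := fun x => ⟨_, hfd x.1 x.2⟩
      map_zero' := by
        ext p i
        simp
      map_add' := by
        intro x y
        ext p i
        simp [mul_add] }
  have hle : ubsH S r ubsM ≤ ubsH S r ⊤ := by
    rintro x ⟨n, hn, P, -, h⟩
    exact ⟨n, hn, P, trivial, h⟩
  have hdiv : ∀ (a : ubsH S r ⊤) (b : ∀ p : S, Fin (r p) → ZMod p),
      (f a).1 = b → a.1 = fun (p : S) i => (((Nat.log 2 p : ℕ) : ZMod p) ^ 2)⁻¹ * b p i := by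
    rintro a b rfl
    ext p i
    have := Fact.mk (hprime p p.2)
    exact (inv_mul_cancel_left₀ (pow_ne_zero 2 (hT p)) _).symm
  refine ⟨ubsH S r ⊤, ubsH S r ubsM, ubs_le S r _, ubs_le S r _, ubs_pure S r _, ubs_pure S r _,
    ubs_red S hprime r _, ubs_red S hprime r _, ⟨f, ?_, ?_⟩,
    ⟨AddSubgroup.inclusion hle, AddSubgroup.inclusion_injective hle, ?_⟩, ?_⟩
  · intro a b hab
    exact Subtype.ext ((hdiv a _ rfl).trans (hdiv b _ (congrArg Subtype.val hab).symm).symm)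
  · intro n a b hab
    obtain ⟨h', hh', e⟩ := ubs_pure S r ⊤ n a.1 a.2
      ⟨fun (p : S) i => (((Nat.log 2 p : ℕ) : ZMod p) ^ 2)⁻¹ * b.1 p i, by
        rw [hdiv a _ (congrArg Subtype.val hab)]
        ext p i
        simp
        ring⟩
    exact ⟨⟨h', hh'⟩, Subtype.ext e⟩
  · intro n a b hab
    obtain ⟨h', hh', e⟩ := ubs_pure S r ubsM n a.1 a.2 ⟨b.1, congrArg Subtype.val hab⟩
    exact ⟨⟨h', hh'⟩, Subtype.ext e⟩
  · rintro ⟨C⟩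
    exact ubs_noniso S hS hprime r hr C
end

section
/- Let S be an infinite set of prime numbers, and let A = ∏_{p∈S} (ℤ/p)ˣ be the product of the unit groups of the fields ℤ/p, equipped with the product topology where each finite factor (ℤ/p)ˣ carries the discrete topology. Then for every nonzero polynomial q ∈ ℤ[X,Y] and every finite subset T ⊆ S, the set X = { (σ, τ) ∈ A × A : for all p ∈ S \ T, q(σ(p), τ(p)) = 0 in ℤ/p } is closed and nowhere dense in A × A. -/
/-- Each finite unit group `(ℤ/n)ˣ` carries the discrete topology. -/
instance (n : ℕ) : TopologicalSpace (ZMod n)ˣ := ⊥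

instance (n : ℕ) : DiscreteTopology (ZMod n)ˣ := ⟨rfl⟩

/-- For `q ∈ ℤ[X,Y]` and a finite `T ⊆ S`, the set of pairs `(σ, τ)` in
`∏_{p ∈ S} (ℤ/p)ˣ × ∏_{p ∈ S} (ℤ/p)ˣ` such that `q(σ(p), τ(p)) = 0` for all
`p ∈ S \ T`. -/
def vanishingSet (S : Set ℕ) (q : MvPolynomial (Fin 2) ℤ) (T : Set ℕ) :
    Set ((∀ p : S, (ZMod p)ˣ) × (∀ p : S, (ZMod p)ˣ)) :=
  {στ | ∀ p : S, (p : ℕ) ∉ T →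
    MvPolynomial.aeval ![((στ.1 p : (ZMod (p : ℕ))ˣ) : ZMod p), ((στ.2 p : (ZMod (p : ℕ))ˣ) : ZMod p)] q = 0}

lemma exists_int_point (q : MvPolynomial (Fin 2) ℤ) (hq : q ≠ 0) :
    ∃ x : Fin 2 → ℤ, x 0 ≠ 0 ∧ x 1 ≠ 0 ∧ MvPolynomial.eval x q ≠ 0 := by
  by_contra hcon
  have h : q * MvPolynomial.X 0 * MvPolynomial.X 1 = 0 := by
    apply MvPolynomial.funext
    intro x
    simp only [map_mul, MvPolynomial.eval_X, map_zero]
    by_contra hne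
    exact hcon ⟨x, fun h0 => hne (by simp [h0]), fun h0 => hne (by simp [h0]),
      fun h0 => hne (by simp [h0])⟩
  simp [hq, MvPolynomial.X_ne_zero] at h

lemma tendsto_update_cofinite {ι : Type*} {F : ι → Type*} [DecidableEq ι]
    [∀ i, TopologicalSpace (F i)] (f g : ∀ i, F i) :
    Filter.Tendsto (fun i => Function.update f i (g i)) Filter.cofinite (nhds f) := by
  rw [tendsto_pi_nhds]
  intro j
  apply tendsto_const_nhds.congr'
  have : ∀ᶠ i in Filter.cofinite, i ≠ j := by
    simp [Filter.eventually_cofinite]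
  filter_upwards [this] with i hi
  rw [Function.update_of_ne (Ne.symm hi)]

open Classical in
noncomputable def intUnit (a : ℤ) (p : ℕ) : (ZMod p)ˣ :=
  if h : IsUnit (a : ZMod p) then h.unit else 1

lemma intUnit_coe (a : ℤ) (p : ℕ) (h : IsUnit (a : ZMod p)) :
    ((intUnit a p : (ZMod p)ˣ) : ZMod p) = a := by
  simp [intUnit, h]

lemma cast_ne_zero_of_lt (a : ℤ) (ha : a ≠ 0) (p : ℕ) (h : a.natAbs < p) :
    (a : ZMod p) ≠ 0 := by
  rw [Ne, ZMod.intCast_zmod_eq_zero_iff_dvd, Int.natCast_dvd]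
  intro hd
  exact absurd (Nat.le_of_dvd (Int.natAbs_pos.mpr ha) hd) (by omega)

theorem vanishingSet_isClosed_isNowhereDense (S : Set ℕ) (hS : S.Infinite)
    (hprime : ∀ p ∈ S, p.Prime) (q : MvPolynomial (Fin 2) ℤ) (hq : q ≠ 0)
    (T : Set ℕ) (hT : T.Finite) (hTS : T ⊆ S) :
    IsClosed (vanishingSet S q T) ∧ IsNowhereDense (vanishingSet S q T) := by
  classical
  have hcl : IsClosed (vanishingSet S q T) := by
    unfold vanishingSet
    simp only [Set.ofPred_forall]
    refine isClosed_iInter fun p => isClosed_iInter fun _ => ?_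
    have hc : Continuous (fun στ : (∀ p : S, (ZMod p)ˣ) × (∀ p : S, (ZMod p)ˣ) =>
        (στ.1 p, στ.2 p)) := by fun_prop
    exact (isClosed_discrete {z : (ZMod (p : ℕ))ˣ × (ZMod (p : ℕ))ˣ |
      MvPolynomial.aeval ![(z.1 : ZMod p), (z.2 : ZMod p)] q = 0}).preimage hc
  refine ⟨hcl, ?_⟩
  rw [IsNowhereDense, hcl.closure_eq, Set.eq_empty_iff_forall_notMem]
  rintro ⟨σ, τ⟩ hmem
  obtain ⟨x, h0, h1, hx⟩ := exists_int_point q hq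
  have : Infinite S := hS.to_subtype
  have ht := (tendsto_update_cofinite σ (fun p : S => intUnit (x 0) p)).prodMk_nhds
    (tendsto_update_cofinite τ (fun p : S => intUnit (x 1) p))
  have hev := ht.eventually (mem_interior_iff_mem_nhds.mp hmem)
  have hfin : ∀ B : Set ℕ, B.Finite → ∀ᶠ p : S in Filter.cofinite, (p : ℕ) ∉ B := fun B hB =>
    (Subtype.val_injective.tendsto_cofinite).eventually hB.eventually_cofinite_notMem
  obtain ⟨p, hp, hpT, hp0, hp1, hpx⟩ := (hev.and ((hfin T hT).and
    ((hfin _ (Set.finite_Iic (x 0).natAbs)).and ((hfin _ (Set.finite_Iic (x 1).natAbs)).and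
      (hfin _ (Set.finite_Iic (MvPolynomial.eval x q).natAbs)))))).exists
  simp only [Set.mem_Iic, not_le] at hp0 hp1 hpx
  have : Fact (p : ℕ).Prime := ⟨hprime p p.2⟩
  have hz := hp p hpT
  simp only [Function.update_self] at hz
  rw [intUnit_coe _ _ (cast_ne_zero_of_lt _ h0 _ hp0).isUnit,
    intUnit_coe _ _ (cast_ne_zero_of_lt _ h1 _ hp1).isUnit] at hz
  apply cast_ne_zero_of_lt _ hx _ hpx
  rw [← hz]
  have hv : (![((x 0 : ℤ) : ZMod p), ((x 1 : ℤ) : ZMod p)]) =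
      fun i => algebraMap ℤ (ZMod p) (x i) := by
    ext i; fin_cases i <;> simp
  rw [hv]
  have := MvPolynomial.aeval_algebraMap_apply (ZMod p) x q
  simp only [Function.comp_def] at this
  rw [this, MvPolynomial.aeval_eq_eval]
  simp
end

section
/- Let S be an infinite set of prime numbers. There exist families σ₁, σ₂ ∈ ∏_{p∈S} (ℤ/p)ˣ such that for every nonzero polynomial q ∈ ℤ[X,Y], the set { p ∈ S : q(σ₁(p), σ₂(p)) ≠ 0 in ℤ/p } is infinite. -/
theorem exists_good_units (q : MvPolynomial (Fin 2) ℤ) (hq : q ≠ 0) :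
    ∃ N : ℕ, N ≠ 0 ∧ ∀ p : ℕ, p.Prime → ¬ p ∣ N →
      ∃ u : (ZMod p)ˣ × (ZMod p)ˣ,
        MvPolynomial.aeval ![(u.1 : ZMod p), (u.2 : ZMod p)] q ≠ 0 := by
  have h1 : q * (MvPolynomial.X 0 * MvPolynomial.X 1) ≠ 0 :=
    mul_ne_zero hq (mul_ne_zero (MvPolynomial.X_ne_zero _) (MvPolynomial.X_ne_zero _))
  have h2 : ∃ x : Fin 2 → ℤ,
      MvPolynomial.eval x (q * (MvPolynomial.X 0 * MvPolynomial.X 1)) ≠ 0 := by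
    by_contra! h
    exact h1 (MvPolynomial.funext (fun x => by rw [h x, map_zero]))
  obtain ⟨x, hx⟩ := h2
  simp only [map_mul, MvPolynomial.eval_X] at hx
  refine ⟨(MvPolynomial.eval x q * (x 0 * x 1)).natAbs, Int.natAbs_ne_zero.2 hx, ?_⟩
  intro p hp hd
  haveI : Fact p.Prime := ⟨hp⟩
  have hd' : ((MvPolynomial.eval x q * (x 0 * x 1) : ℤ) : ZMod p) ≠ 0 := by
    intro h
    rw [ZMod.intCast_zmod_eq_zero_iff_dvd] at h
    exact hd (Int.natCast_dvd.1 h)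
  push_cast at hd'
  have ha := left_ne_zero_of_mul hd'
  have hb := left_ne_zero_of_mul (right_ne_zero_of_mul hd')
  have hc := right_ne_zero_of_mul (right_ne_zero_of_mul hd')
  refine ⟨(Units.mk0 _ hb, Units.mk0 _ hc), ?_⟩
  have hv : ![((Units.mk0 _ hb : (ZMod p)ˣ) : ZMod p), ((Units.mk0 _ hc : (ZMod p)ˣ) : ZMod p)]
      = fun i => algebraMap ℤ (ZMod p) (x i) := by
    funext i
    fin_cases i <;> simp
  simp only [hv]
  have := MvPolynomial.aeval_algebraMap_apply (ZMod p) x q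
  rw [show (fun i => algebraMap ℤ (ZMod p) (x i)) = algebraMap ℤ (ZMod p) ∘ x from rfl, this]
  simpa [MvPolynomial.aeval_eq_eval] using ha

/-- For an infinite set `S` of primes, there are families of units
`σ₁, σ₂ ∈ ∏_{p ∈ S} (ℤ/p)ˣ` such that for every nonzero integer polynomial `q` in
two variables, `q(σ₁(p), σ₂(p)) ≠ 0` for infinitely many `p ∈ S`. -/
theorem exists_generic_unit_families (S : Set ℕ) (hS : S.Infinite)
    (hprime : ∀ p ∈ S, p.Prime) :
    ∃ σ₁ σ₂ : ∀ p : S, (ZMod p)ˣ,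
      ∀ q : MvPolynomial (Fin 2) ℤ, q ≠ 0 →
        {p : S |
          MvPolynomial.aeval
            ![((σ₁ p : (ZMod (p : ℕ))ˣ) : ZMod p), ((σ₂ p : (ZMod (p : ℕ))ˣ) : ZMod p)] q ≠ 0}.Infinite := by
  classical
  haveI : Infinite S := hS.to_subtype
  obtain ⟨e⟩ : Nonempty (S ≃ ℕ) := nonempty_equiv_of_countable
  haveI : Countable (MvPolynomial (Fin 2) ℤ) := by
    rw [← Cardinal.mk_le_aleph0_iff]
    exact MvPolynomial.cardinalMk_le_max.trans (by simp)
  obtain ⟨g, hg⟩ := exists_surjective_nat (MvPolynomial (Fin 2) ℤ)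
  have key : ∀ p : S, ∃ u : (ZMod (p : ℕ))ˣ × (ZMod (p : ℕ))ˣ,
      (∃ v : (ZMod (p : ℕ))ˣ × (ZMod (p : ℕ))ˣ,
        MvPolynomial.aeval ![(v.1 : ZMod (p : ℕ)), (v.2 : ZMod (p : ℕ))]
          (g (Nat.unpair (e p)).1) ≠ 0) →
      MvPolynomial.aeval ![(u.1 : ZMod (p : ℕ)), (u.2 : ZMod (p : ℕ))]
          (g (Nat.unpair (e p)).1) ≠ 0 := by
    intro p
    by_cases h : ∃ v : (ZMod (p : ℕ))ˣ × (ZMod (p : ℕ))ˣ,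
        MvPolynomial.aeval ![(v.1 : ZMod (p : ℕ)), (v.2 : ZMod (p : ℕ))]
          (g (Nat.unpair (e p)).1) ≠ 0
    · exact ⟨h.choose, fun _ => h.choose_spec⟩
    · exact ⟨1, fun h' => absurd h' h⟩
  choose u hu using key
  refine ⟨fun p => (u p).1, fun p => (u p).2, fun q hq => ?_⟩
  obtain ⟨n, rfl⟩ := hg q
  obtain ⟨N, hN, hgood⟩ := exists_good_units _ hq
  have hfib : {p : S | (Nat.unpair (e p)).1 = n}.Infinite := by
    refine Set.infinite_of_injective_forall_mem (f := fun k => e.symm (Nat.pair n k)) ?_ ?_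
    · intro a b h
      have := e.symm.injective h
      simpa using this
    · intro k
      simp
  have hbad : {p : S | (p : ℕ) ∣ N}.Finite := by
    refine Set.Finite.subset ((Set.finite_Iic N).preimage Subtype.val_injective.injOn) ?_
    intro p hp
    exact Nat.le_of_dvd (Nat.pos_of_ne_zero hN) hp
  refine (hfib.diff hbad).mono ?_
  rintro p ⟨hp1, hp2⟩
  have h := hu p
  rw [show (Nat.unpair (e p)).1 = n from hp1] at h
  exact h (hgood p (hprime p p.2) hp2)
end

section
/- Let K be an abelian group and m a positive integer such that the subgroup m•K = { m • x : x ∈ K } is a divisible group. Then K is isomorphic to a direct product D × B, where D is a divisible abelian group and B is an abelian group of exponent dividing m (that is, m • b = 0 for all b ∈ B). In particular, K is the direct sum of a divisible group and a torsion group of bounded exponent. -/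
/-- If `K` is an abelian group, `m` a positive integer, and the subgroup
`m • K = {m • x : x ∈ K}` is divisible (every `m • x` is divisible by every nonzero
`n` within `m • K`), then `K` is isomorphic to a direct product `D × B` with `D`
divisible and `B` of exponent dividing `m`; i.e. `K` is the direct sum of a
divisible group and a torsion group of bounded exponent. -/
theorem decomposition_of_mK_divisible {K : Type*} [AddCommGroup K] (m : ℕ) (hm : 0 < m)
    (hdiv : ∀ (x : K) (n : ℕ), n ≠ 0 → ∃ y : K, n • (m • y) = m • x) :
    ∃ D B : AddSubgroup K,
      (∀ d ∈ D, ∀ n : ℕ, n ≠ 0 → ∃ y ∈ D, n • y = d) ∧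
      (∀ b ∈ B, m • b = 0) ∧
      Nonempty (K ≃+ ↥D × ↥B) := by
  let D : AddSubgroup K := (nsmulAddMonoidHom (α := K) m).range
  have hD : ∀ d ∈ D, ∀ n : ℕ, n ≠ 0 → ∃ y ∈ D, n • y = d := by
    rintro d ⟨x, rfl⟩ n hn
    obtain ⟨y, hy⟩ := hdiv x n hn
    exact ⟨m • y, ⟨y, rfl⟩, hy⟩
  have hsurj : ∀ {n : ℤ}, n ≠ 0 → Function.Surjective (fun a : D => n • a) := by
    rintro n hn ⟨d, hd⟩
    obtain ⟨y, hy, h⟩ := hD d hd n.natAbs (Int.natAbs_ne_zero.mpr hn)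
    rcases Int.natAbs_eq n with h' | h'
    · refine ⟨⟨y, hy⟩, Subtype.ext ?_⟩
      change n • y = d
      rw [h', natCast_zsmul, h]
    · refine ⟨⟨-y, D.neg_mem hy⟩, Subtype.ext ?_⟩
      change n • (-y) = d
      rw [h', neg_smul, smul_neg, neg_neg, natCast_zsmul, h]
  letI : DivisibleBy D ℤ := divisibleByOfSMulRightSurj D ℤ hsurj
  obtain ⟨f, hf⟩ := (Module.Baer.of_divisible D).extension_property_addMonoidHom
    D.subtype D.subtype_injective (AddMonoidHom.id D)
  have hf' : ∀ d : D, f (d : K) = d := fun d => DFunLike.congr_fun hf d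
  refine ⟨D, f.ker, hD, ?_, ⟨?_⟩⟩
  · intro b hb
    have h1 := hf' ⟨m • b, ⟨b, rfl⟩⟩
    have h2 : f (m • b) = 0 := by
      rw [map_nsmul, AddMonoidHom.mem_ker.mp hb, smul_zero]
    have h3 := h1.symm.trans h2
    exact congrArg Subtype.val h3
  · exact
      { toFun := fun x => (f x, ⟨x - f x, by
          rw [AddMonoidHom.mem_ker, map_sub, hf', sub_self]⟩)
        invFun := fun p => (p.1 : K) + (p.2 : K)
        left_inv := fun x => by simp
        right_inv := fun p => by
          obtain ⟨d, b, hb⟩ := p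
          have hb' : f b = 0 := hb
          have : f ((d : K) + b) = d := by rw [map_add, hf', hb', add_zero]
          ext
          · simp [this]
          · simp [this]
        map_add' := fun x y => by
          ext
          · simp
          · simp; abel }
end
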